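/- arXiv:1507.06329 — 2 statements merged into one kernel-verified Lean document; each statement's English description precedes it below -/
import Mathlib

section
/- Let G be a finite elementary abelian p-group (every nonidentity element has order p) and let D ⊆ G with |D| = |G| - c ≥ c. Let b ∈ G and 0 ≤ k ≤ |D|. Then |N(D,k,b) - (1/|G|)·C(|G|-c, k)| ≤ C((|G|-2c)/p + c + k - 1, k). -/
open Finset

/-- `N(D, k, b)`: the number of `k`-element subsets `S ⊆ D` with `∑_{x ∈ S} x = b`. -/
def subsetSumCount {G : Type*} [AddCommGroup G] [DecidableEq G]
    (D : Finset G) (k : ℕ) (b : G) : ℕ :=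
  ((D.powersetCard k).filter (fun S => ∑ x ∈ S, x = b)).card

/-- The real "binomial coefficient" `C(x, k) = x(x-1)⋯(x-k+1)/k!`. -/
noncomputable def realChoose (x : ℝ) (k : ℕ) : ℝ :=
  (∏ j ∈ Finset.range k, (x - j)) / (Nat.factorial k)

/-- The rising binomial coefficient `s(s+1)⋯(s+k-1)/k!`. -/
noncomputable def risingChoose (s : ℝ) (k : ℕ) : ℝ :=
  (∏ j ∈ Finset.range k, (s + j)) / (Nat.factorial k)

theorem realChoose_add_sub_one (s : ℝ) (k : ℕ) :
    realChoose (s + k - 1) k = risingChoose s k := by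
  unfold realChoose risingChoose
  congr 1
  rw [← Finset.prod_range_reflect]
  refine Finset.prod_congr rfl fun j hj => ?_
  have hjk : j + 1 ≤ k := Finset.mem_range.1 hj
  rw [Nat.sub_sub, Nat.cast_sub (by omega)]
  push_cast
  ring

theorem realChoose_natCast (n k : ℕ) : realChoose n k = n.choose k := by
  unfold realChoose
  rw [Nat.cast_choose_eq_descPochhammer_div, descPochhammer_eval_eq_prod_range]

theorem risingChoose_zero (s : ℝ) : risingChoose s 0 = 1 := by
  simp [risingChoose]

theorem succ_mul_risingChoose_succ (s : ℝ) (k : ℕ) :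
    ((k : ℝ) + 1) * risingChoose s (k + 1) = (s + k) * risingChoose s k := by
  unfold risingChoose
  rw [Finset.prod_range_succ, Nat.factorial_succ]
  push_cast
  field_simp

theorem risingChoose_nonneg {s : ℝ} (hs : 0 ≤ s) (k : ℕ) : 0 ≤ risingChoose s k := by
  unfold risingChoose
  positivity

theorem risingChoose_monotone {s : ℝ} (hs : 1 ≤ s) : Monotone (risingChoose s) := by
  refine monotone_nat_of_le_succ fun k => ?_
  have h := succ_mul_risingChoose_succ s k
  have h0 := risingChoose_nonneg (zero_le_one.trans hs) k
  have hk : (0 : ℝ) < (k : ℝ) + 1 := by positivity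
  refine le_of_mul_le_mul_left ?_ hk
  rw [h]
  gcongr ?_ * _
  linarith

theorem natCast_mul_risingChoose (s : ℝ) (k : ℕ) :
    (k : ℝ) * risingChoose s k = s * ∑ j ∈ Finset.range k, risingChoose s j := by
  induction k with
  | zero => simp
  | succ k ih =>
    rw [Finset.sum_range_succ, mul_add, ← ih]
    push_cast
    rw [succ_mul_risingChoose_succ]
    ring

/-- For a nonnegative monotone sequence, the terms at distance divisible by `p` from the end
make up at most a `1 / p` fraction of a partial sum. -/
theorem sum_range_dvd_sub_le {p : ℕ} (hp : 0 < p) {r : ℕ → ℝ} (hr : Monotone r)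
    (h0 : ∀ k, 0 ≤ r k) (k : ℕ) :
    ∑ j ∈ Finset.range k, (if p ∣ k - j then (p : ℝ) * r j else 0)
      ≤ ∑ j ∈ Finset.range k, r j := by
  induction k using Nat.strong_induction_on with
  | _ k ih =>
    rcases lt_or_ge k p with hk | hk
    · refine Finset.sum_le_sum fun j hj => ?_
      have hj' := Finset.mem_range.1 hj
      rw [if_neg (Nat.not_dvd_of_pos_of_lt (by omega) (by omega))]
      exact h0 j
    · obtain ⟨m, rfl⟩ := Nat.exists_eq_add_of_le' hk
      rw [Finset.sum_range_add, Finset.sum_range_add]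
      refine add_le_add ((Finset.sum_le_sum fun j hj => ?_).trans (ih m (by omega))) ?_
      · have hj' := Finset.mem_range.1 hj
        have : m + p - j = m - j + p := by omega
        simp only [this, Nat.dvd_add_self_right, le_refl]
      · rw [Finset.sum_eq_single_of_mem 0 (Finset.mem_range.2 hp)]
        · have : ∑ _j ∈ Finset.range p, r m ≤ ∑ j ∈ Finset.range p, r (m + j) :=
            Finset.sum_le_sum fun j _ => hr (Nat.le_add_right m j)
          simpa using this
        · intro j hj hj0
          have hj' := Finset.mem_range.1 hj
          exact if_neg (Nat.not_dvd_of_pos_of_lt (by omega) (by omega))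

/-- A norm form of Newton's identities. -/
theorem natCast_mul_norm_esymm_le {α : Type*} (D : Finset α) (f : α → ℂ) (k : ℕ) :
    (k : ℝ) * ‖(D.val.map f).esymm k‖
      ≤ ∑ j ∈ Finset.range k, ‖(D.val.map f).esymm j‖ * ‖∑ x ∈ D, f x ^ (k - j)‖ := by
  have hmap : Multiset.map (fun x : D => f x) Finset.univ.val = D.val.map f := by
    rw [Finset.univ_eq_attach, Finset.attach_val]
    exact Multiset.attach_map_val' _ _
  have h := congrArg (MvPolynomial.aeval (fun x : D => f x))
    (MvPolynomial.mul_esymm_eq_sum D ℂ k)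
  simp only [map_mul, map_natCast, map_pow, map_neg, map_one, map_sum,
    MvPolynomial.aeval_esymm_eq_multiset_esymm, hmap, MvPolynomial.psum, MvPolynomial.aeval_X] at h
  have h' := congrArg norm h
  rw [norm_mul, norm_mul, norm_pow, norm_neg, norm_one, one_pow, one_mul,
    Complex.norm_natCast] at h'
  rw [h']
  refine (norm_sum_le _ _).trans (le_of_eq ?_)
  rw [Finset.sum_filter, Finset.Nat.sum_antidiagonal_eq_sum_range_succ_mk, Finset.sum_range_succ,
    if_neg (lt_irrefl k), add_zero]
  refine Finset.sum_congr rfl fun j hj => ?_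
  rw [if_pos (Finset.mem_range.1 hj), norm_mul, norm_mul, norm_pow, norm_neg, norm_one, one_pow,
    one_mul, Finset.sum_coe_sort D (fun x => f x ^ (k - j))]

theorem norm_sum_addChar_le_compl {G : Type*} [AddCommGroup G] [Fintype G] [DecidableEq G]
    {ψ : AddChar G ℂ} (hψ : ψ ≠ 0) (D : Finset G) :
    ‖∑ x ∈ D, ψ x‖ ≤ (Dᶜ.card : ℝ) := by
  have h := Finset.sum_add_sum_compl D (fun x => ψ x)
  rw [AddChar.sum_eq_zero_iff_ne_zero.2 hψ] at h
  rw [eq_neg_of_add_eq_zero_left h, norm_neg]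
  refine (norm_sum_le _ _).trans ?_
  simp [AddChar.norm_apply]

theorem norm_sum_addChar_le_card {G : Type*} [AddCommGroup G] [Finite G]
    (ψ : AddChar G ℂ) (D : Finset G) :
    ‖∑ x ∈ D, ψ x‖ ≤ (D.card : ℝ) := by
  refine (norm_sum_le _ _).trans ?_
  simp [AddChar.norm_apply]

theorem addChar_pow_ne_zero {G : Type*} [AddCommGroup G] {p : ℕ} (hp : p.Prime)
    (hG : ∀ g : G, g ≠ 0 → addOrderOf g = p)
    {ψ : AddChar G ℂ} (hψ : ψ ≠ 0) {i : ℕ} (hi : ¬ p ∣ i) : ψ ^ i ≠ 0 := by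
  obtain ⟨x, hx⟩ := AddChar.ne_zero_iff.1 hψ
  have hx0 : x ≠ 0 := by
    rintro rfl
    exact hx ψ.map_zero_eq_one
  refine AddChar.ne_zero_iff.2 ⟨x, fun h => hx ?_⟩
  have hpow : ψ x ^ p = 1 := by
    rw [← AddChar.map_nsmul_eq_pow, ← hG x hx0, addOrderOf_nsmul_eq_zero, AddChar.map_zero_eq_one]
  have hgcd := pow_gcd_eq_one.2 ⟨hpow, h⟩
  rwa [((Nat.Prime.coprime_iff_not_dvd hp).2 hi).gcd_eq_one, pow_one] at hgcd

theorem norm_esymm_addChar_le {G : Type*} [AddCommGroup G] [Fintype G] {p : ℕ} (hp : p.Prime)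
    (hG : ∀ g : G, g ≠ 0 → addOrderOf g = p) {D : Finset G} {c : ℕ}
    (hD : D.card + c = Fintype.card G) (hc : c ≤ D.card) {ψ : AddChar G ℂ} (hψ : ψ ≠ 0) (k : ℕ) :
    ‖(D.val.map ψ).esymm k‖ ≤ risingChoose (((Fintype.card G : ℝ) - 2 * c) / p + c) k := by
  classical
  set s : ℝ := ((Fintype.card G : ℝ) - 2 * c) / p + c with hs
  have hp0 : (0 : ℝ) < p := by exact_mod_cast hp.pos
  have hDr : (D.card : ℝ) + c = Fintype.card G := by exact_mod_cast hD
  have hcr : (c : ℝ) ≤ D.card := by exact_mod_cast hc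
  have ha : 0 ≤ ((Fintype.card G : ℝ) - 2 * c) / p := div_nonneg (by linarith) hp0.le
  have hs1 : 1 ≤ s := by
    rcases Nat.eq_zero_or_pos c with rfl | hcpos
    · obtain ⟨x, hx⟩ := AddChar.ne_zero_iff.1 hψ
      have hx0 : x ≠ 0 := by
        rintro rfl
        exact hx ψ.map_zero_eq_one
      have hle : p ≤ Fintype.card G := by
        rw [← hG x hx0]
        exact addOrderOf_le_card_univ
      have hle' : (p : ℝ) ≤ Fintype.card G := by exact_mod_cast hle
      rw [hs, Nat.cast_zero, mul_zero, sub_zero, add_zero, one_le_div hp0]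
      exact hle'
    · have : (1 : ℝ) ≤ c := by exact_mod_cast hcpos
      linarith
  have hr0 := risingChoose_nonneg (zero_le_one.trans hs1)
  have hcompl : (Dᶜ.card : ℝ) = c := by
    rw [Finset.card_compl, ← hD, Nat.add_sub_cancel_left]
  have hpsum (i : ℕ) : ‖∑ x ∈ D, ψ x ^ i‖
      ≤ (c : ℝ) + if p ∣ i then (Fintype.card G : ℝ) - 2 * c else 0 := by
    split_ifs with hi
    · have := norm_sum_addChar_le_card (ψ ^ i) D
      simp only [AddChar.pow_apply] at this
      linarith
    · have := norm_sum_addChar_le_compl (addChar_pow_ne_zero hp hG hψ hi) D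
      simp only [AddChar.pow_apply] at this
      linarith
  induction k using Nat.strong_induction_on with
  | _ k ih =>
    rcases Nat.eq_zero_or_pos k with rfl | hk
    · simp [risingChoose_zero, Multiset.esymm]
    have hkr : (0 : ℝ) < k := by exact_mod_cast hk
    refine le_of_mul_le_mul_left ?_ hkr
    calc (k : ℝ) * ‖(D.val.map ψ).esymm k‖
        ≤ ∑ j ∈ Finset.range k, ‖(D.val.map ψ).esymm j‖ * ‖∑ x ∈ D, ψ x ^ (k - j)‖ :=
          natCast_mul_norm_esymm_le D ψ k
      _ ≤ ∑ j ∈ Finset.range k, risingChoose s j *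
            ((c : ℝ) + if p ∣ k - j then (Fintype.card G : ℝ) - 2 * c else 0) :=
          Finset.sum_le_sum fun j hj =>
            mul_le_mul (ih j (Finset.mem_range.1 hj)) (hpsum _) (norm_nonneg _) (hr0 j)
      _ = c * ∑ j ∈ Finset.range k, risingChoose s j +
            ((Fintype.card G : ℝ) - 2 * c) / p *
              ∑ j ∈ Finset.range k, (if p ∣ k - j then (p : ℝ) * risingChoose s j else 0) := by
          rw [Finset.mul_sum, Finset.mul_sum, ← Finset.sum_add_distrib]
          refine Finset.sum_congr rfl fun j _ => ?_
          split_ifs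
          · field_simp
          · ring
      _ ≤ c * ∑ j ∈ Finset.range k, risingChoose s j +
            ((Fintype.card G : ℝ) - 2 * c) / p * ∑ j ∈ Finset.range k, risingChoose s j := by
          refine add_le_add_right (mul_le_mul_of_nonneg_left ?_ ha) _
          exact sum_range_dvd_sub_le hp.pos (risingChoose_monotone hs1) hr0 k
      _ = k * risingChoose s k := by
          rw [natCast_mul_risingChoose, hs]
          ring

theorem card_mul_subsetSumCount {G : Type*} [AddCommGroup G] [Fintype G] [DecidableEq G]
    (D : Finset G) (k : ℕ) (b : G) :
    (Fintype.card G : ℂ) * subsetSumCount D k b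
      = ∑ ψ : AddChar G ℂ, ψ (-b) * (D.val.map ψ).esymm k := by
  simp_rw [Finset.esymm_map_val, Finset.mul_sum]
  rw [Finset.sum_comm, subsetSumCount, Finset.card_filter, Nat.cast_sum, Finset.mul_sum]
  refine Finset.sum_congr rfl fun S hS => ?_
  have hprod (ψ : AddChar G ℂ) : ψ (-b) * S.prod ψ = ψ (∑ x ∈ S, x - b) := by
    rw [sub_eq_neg_add, AddChar.map_add_eq_mul]
    congr 1
    clear hS
    induction S using Finset.induction_on with
    | empty => simp
    | insert a S ha ih => rw [Finset.prod_insert ha, Finset.sum_insert ha,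
        AddChar.map_add_eq_mul, ih]
  simp_rw [hprod]
  rw [AddChar.sum_apply_eq_ite]
  simp [sub_eq_zero]

/-- **Proposition (subset sums over an elementary abelian `p`-group).**
If `G` is a finite elementary abelian `p`-group (every nonzero element has order `p`),
`D ⊆ G` with `|D| = |G| - c ≥ c` and `0 ≤ k ≤ |D|`, then
`|N(D,k,b) - (1/|G|)·C(|G|-c, k)| ≤ C((|G|-2c)/p + c + k - 1, k)`. -/
theorem subsetSum_asymptotic_elementary_abelian
    (G : Type*) [AddCommGroup G] [Fintype G] [DecidableEq G]
    (p : ℕ) (hp : p.Prime) (hG : ∀ g : G, g ≠ 0 → addOrderOf g = p)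
    (D : Finset G) (c k : ℕ) (b : G)
    (hD : D.card + c = Fintype.card G) (hc : c ≤ D.card) (hk : k ≤ D.card) :
    |(subsetSumCount D k b : ℝ)
        - (1 / (Fintype.card G : ℝ)) * realChoose ((Fintype.card G : ℝ) - c) k|
      ≤ realChoose (((Fintype.card G : ℝ) - 2 * c) / p + c + k - 1) k := by
  have hn : (0 : ℝ) < Fintype.card G := by exact_mod_cast Fintype.card_pos
  have hDr : (Fintype.card G : ℝ) - c = D.card := by
    rw [← hD]
    push_cast
    ring
  have hp0 : (0 : ℝ) < p := by exact_mod_cast hp.pos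
  have hs0 : 0 ≤ ((Fintype.card G : ℝ) - 2 * c) / p + c := by
    have hcr : (c : ℝ) ≤ D.card := by exact_mod_cast hc
    have := div_nonneg (show (0 : ℝ) ≤ Fintype.card G - 2 * c by linarith) hp0.le
    positivity
  rw [realChoose_add_sub_one, hDr, realChoose_natCast]
  set R := risingChoose (((Fintype.card G : ℝ) - 2 * c) / p + c) k with hR
  have hR0 : 0 ≤ R := risingChoose_nonneg hs0 k
  have hmain := card_mul_subsetSumCount D k b
  rw [← Finset.add_sum_erase _ _ (Finset.mem_univ 0)] at hmain
  have htriv : (0 : AddChar G ℂ) (-b) * (D.val.map (0 : AddChar G ℂ)).esymm k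
      = (D.card.choose k : ℂ) := by
    rw [Finset.esymm_map_val]
    simp
  rw [htriv, ← sub_eq_iff_eq_add'] at hmain
  have hnorm : ‖(Fintype.card G : ℂ) * subsetSumCount D k b - D.card.choose k‖
      ≤ Fintype.card G * R := by
    rw [hmain]
    calc ‖∑ ψ ∈ Finset.univ.erase (0 : AddChar G ℂ), ψ (-b) * (D.val.map ψ).esymm k‖
        ≤ ∑ ψ ∈ Finset.univ.erase (0 : AddChar G ℂ), ‖ψ (-b) * (D.val.map ψ).esymm k‖ :=
          norm_sum_le _ _
      _ ≤ ∑ _ψ ∈ Finset.univ.erase (0 : AddChar G ℂ), R := by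
          refine Finset.sum_le_sum fun ψ hψ => ?_
          rw [norm_mul, AddChar.norm_apply, one_mul]
          exact norm_esymm_addChar_le hp hG hD hc (Finset.ne_of_mem_erase hψ) k
      _ ≤ ∑ _ψ : AddChar G ℂ, R :=
          Finset.sum_le_sum_of_subset_of_nonneg (Finset.erase_subset _ _) fun _ _ _ => hR0
      _ = Fintype.card G * R := by
          rw [Finset.sum_const, Finset.card_univ, AddChar.card_eq, nsmul_eq_mul]
  have hreal : |(Fintype.card G : ℝ) * subsetSumCount D k b - D.card.choose k|
      ≤ Fintype.card G * R := by
    rw [← Real.norm_eq_abs, ← Complex.norm_real]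
    push_cast
    exact hnorm
  refine le_of_mul_le_mul_left ?_ hn
  have hscale : (Fintype.card G : ℝ) *
      (subsetSumCount D k b - 1 / (Fintype.card G : ℝ) * D.card.choose k)
        = Fintype.card G * subsetSumCount D k b - D.card.choose k := by
    field_simp
  rwa [← hscale, abs_mul, abs_of_pos hn] at hreal
end

section
/- Let n = p^t be a prime power (t ≥ 1). Let f(x) = a_d x^d + ⋯ + a_1 x + a_0 ∈ ℤ[x] have degree d ≥ 1 with gcd(a_d, …, a_1, p) = 1. Let D ⊆ ℤ/nℤ with |D| = n - c, and assume n - c ≥ 4.41 · n · p^{-1/d} + c. Then for every b ∈ ℤ/nℤ and every 0 ≤ k ≤ |D|, |N_f(D,k,b) - (1/n)·C(n-c, k)| ≤ C((n-c)/p + (1 - 1/p)(4.41 · n · p^{-1/d} + c) + k - 1, k). -/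
open Finset

/-- `N_f(D, k, b)`: the number of `k`-element subsets `S ⊆ D` with `∑_{x ∈ S} f(x) = b`. -/
def polySubsetSumCount {R : Type*} [CommRing R] [DecidableEq R]
    (D : Finset R) (f : Polynomial R) (k : ℕ) (b : R) : ℕ :=
  ((D.powersetCard k).filter (fun S => ∑ x ∈ S, f.eval x = b)).card

/-- The power sum `∑ x ^ k` over a multiset. -/
def powerSum {A : Type*} [CommRing A] (s : Multiset A) (k : ℕ) : A :=
  (s.map (fun x => x ^ k)).sum

/-- Newton's identities for a multiset, with signs absorbed into the elementary symmetric
functions. -/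
theorem mul_signed_esymm_eq {A : Type*} [CommRing A] (s : Multiset A) (k : ℕ) :
    (k : A) * ((-1) ^ k * s.esymm k) =
      -∑ i ∈ range k, powerSum s (i + 1) * ((-1) ^ (k - 1 - i) * s.esymm (k - 1 - i)) := by
  obtain ⟨n, g, rfl⟩ : ∃ (n : ℕ) (g : Fin n → A), s = Finset.univ.val.map g := by
    refine ⟨s.toList.length, s.toList.get, ?_⟩
    conv_lhs => rw [← s.coe_toList]
    rw [Fin.univ_val_map, List.ofFn_get]
  have h := congrArg (MvPolynomial.aeval g) (MvPolynomial.mul_esymm_eq_sum (Fin n) A k)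
  simp only [map_mul, map_natCast, map_pow, map_neg, map_one, map_sum,
    MvPolynomial.aeval_esymm_eq_multiset_esymm] at h
  have hp : ∀ j, MvPolynomial.aeval g (MvPolynomial.psum (Fin n) A j)
      = powerSum (Finset.univ.val.map g) j := by
    intro j
    rw [MvPolynomial.psum, map_sum, powerSum, Multiset.map_map]
    simp only [map_pow, MvPolynomial.aeval_X]
    rfl
  simp only [hp] at h
  have e : (k : A) * ((-1) ^ k * (Finset.univ.val.map g).esymm k) =
      (-1) ^ k * ((k : A) * (Finset.univ.val.map g).esymm k) := by ring
  rw [e, h, ← mul_assoc, ← pow_add, Odd.neg_one_pow (by exact ⟨k, by ring⟩), neg_one_mul]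
  congr 1
  rw [sum_filter, Finset.Nat.sum_antidiagonal_eq_sum_range_succ_mk, sum_range_succ]
  simp only [lt_self_iff_false, if_false, add_zero]
  rw [← sum_range_reflect]
  refine sum_congr rfl fun i hi => ?_
  rw [mem_range] at hi
  rw [if_pos (by omega), show k - (k - 1 - i) = i + 1 by omega]
  ring

/-- If the first coefficients agree, so do the first power sums. -/
theorem powerSum_eq_of_signed_esymm_eq {A : Type*} [CommRing A] (s t : Multiset A) (e : ℕ)
    (h : ∀ j < e, s.esymm j = t.esymm j) : ∀ j < e, 0 < j → powerSum s j = powerSum t j := by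
  intro j
  induction j using Nat.strong_induction_on with
  | _ j ih =>
    intro hj h0
    obtain ⟨j, rfl⟩ : ∃ i, j = i + 1 := ⟨j - 1, by omega⟩
    have hs := mul_signed_esymm_eq s (j + 1)
    have ht := mul_signed_esymm_eq t (j + 1)
    rw [h _ hj, ht, sum_range_succ, sum_range_succ, neg_inj] at hs
    rw [sum_congr rfl fun i hi => by
      rw [← ih (i + 1) (by simp at hi; omega) (by simp at hi; omega) (by omega),
        ← h _ (by omega)]] at hs
    simpa [Multiset.esymm] using hs.symm

theorem powerSum_sub_of_signed_esymm_eq {A : Type*} [CommRing A] (s t : Multiset A) (e : ℕ)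
    (he : 0 < e) (h : ∀ j < e, s.esymm j = t.esymm j) :
    powerSum s e = powerSum t e - e * ((-1) ^ e * s.esymm e - (-1) ^ e * t.esymm e) := by
  obtain ⟨j, rfl⟩ : ∃ i, e = i + 1 := ⟨e - 1, by omega⟩
  have hs := mul_signed_esymm_eq s (j + 1)
  have ht := mul_signed_esymm_eq t (j + 1)
  rw [mul_sub, hs, ht, sum_range_succ, sum_range_succ]
  rw [sum_congr rfl fun i hi => by
      rw [powerSum_eq_of_signed_esymm_eq s t _ h (i + 1) (by simp at hi; omega) (by omega),
        h _ (by omega)]]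
  simp [Multiset.esymm]

/-- A sequence satisfying Newton's recursion with the coefficients of `s` has the power
sums of `s` up to sign. -/
theorem eq_neg_powerSum {A : Type*} [CommRing A] (s : Multiset A) (c S : ℕ → A)
    (hc : ∀ j, c j = (-1) ^ j * s.esymm j)
    (hS : ∀ m : ℕ, (m : A) * c m = ∑ i ∈ range m, S (i + 1) * c (m - 1 - i)) (j : ℕ) (hj : 0 < j) :
    S j = -powerSum s j := by
  induction j using Nat.strong_induction_on with
  | _ j ih =>
    obtain ⟨j, rfl⟩ : ∃ i, j = i + 1 := ⟨j - 1, by omega⟩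
    have h := mul_signed_esymm_eq s (j + 1)
    rw [← hc, hS, sum_range_succ, sum_range_succ, neg_add, ← sum_neg_distrib] at h
    rw [sum_congr rfl fun i hi => by
      rw [ih (i + 1) (by simp at hi; omega) (by omega), hc, neg_mul]] at h
    have h2 := add_left_cancel h
    rw [hc] at h2
    simpa [Multiset.esymm] using h2

theorem realChoose_natCast_s3 (m k : ℕ) : realChoose m k = m.choose k := by
  rw [realChoose, ← descPochhammer_eval_eq_prod_range, descPochhammer_eval_eq_descFactorial,
    Nat.descFactorial_eq_factorial_mul_choose]
  have : (k.factorial : ℝ) ≠ 0 := by positivity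
  push_cast
  field_simp

theorem realChoose_add_succ_sub_one (M : ℝ) (k : ℕ) :
    ((k : ℝ) + 1) * realChoose (M + (k + 1 : ℕ) - 1) (k + 1) =
      (M + k) * realChoose (M + k - 1) k := by
  simp only [realChoose]
  rw [prod_range_succ', Nat.factorial_succ]
  push_cast
  have : ∏ j ∈ range k, (M + (k + 1) - 1 - (j + 1 : ℝ)) = ∏ j ∈ range k, (M + k - 1 - (j : ℝ)) :=
    prod_congr rfl fun j _ => by ring
  rw [this]
  have : (k.factorial : ℝ) ≠ 0 := by positivity
  field_simp
  ring

theorem realChoose_pos (M : ℝ) (hM : 0 < M) (k : ℕ) : 0 < realChoose (M + k - 1) k := by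
  induction k with
  | zero => simp [realChoose]
  | succ k ih =>
    have h := realChoose_add_succ_sub_one M k
    have : 0 < (M + k) * realChoose (M + k - 1) k := by positivity
    rw [← h] at this
    exact pos_of_mul_pos_right this (by positivity)

theorem realChoose_monotone (M : ℝ) (hM : 1 ≤ M) :
    Monotone fun k : ℕ => realChoose (M + k - 1) k := by
  refine monotone_nat_of_le_succ fun k => ?_
  have h := realChoose_add_succ_sub_one M k
  have h0 := realChoose_pos M (by linarith) k
  have h1 := realChoose_pos M (by linarith) (k + 1)
  have : ((k : ℝ) + 1) * realChoose (M + k - 1) k ≤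
      (k + 1) * realChoose (M + (k + 1 : ℕ) - 1) (k + 1) := by
    rw [h]
    exact mul_le_mul_of_nonneg_right (by linarith) h0.le
  exact le_of_mul_le_mul_left this (by positivity)

theorem mul_realChoose_eq_sum (M : ℝ) (k : ℕ) :
    (k : ℝ) * realChoose (M + k - 1) k =
      M * ∑ i ∈ range k, realChoose (M + (k - 1 - i : ℕ) - 1) (k - 1 - i) := by
  rw [sum_range_reflect (fun i => realChoose (M + i - 1) i) k]
  induction k with
  | zero => simp
  | succ k ih =>
    rw [sum_range_succ, mul_add, ← ih, Nat.cast_succ, ← Nat.cast_succ,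
      show ((k.succ : ℕ) : ℝ) = k + 1 by push_cast; ring]
    have := realChoose_add_succ_sub_one M k
    push_cast at this
    rw [this]
    ring

/-- Sampling a sequence along a progression of step `p` costs at most a factor `1 / p`. -/
theorem sum_dvd_le_sum (p : ℕ) (hp : 0 < p) (u : ℕ → ℝ) (hu : Monotone u) (h0 : ∀ k, 0 ≤ u k)
    (k : ℕ) :
    ∑ i ∈ range k, (if p ∣ i + 1 then (p : ℝ) * u (k - 1 - i) else 0) ≤
      ∑ i ∈ range k, u (k - 1 - i) := by
  induction k using Nat.strong_induction_on with
  | _ k ih =>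
    have hd : ∀ i ∈ range (p - 1), ¬ p ∣ i + 1 := fun i hi h => by
      have := Nat.le_of_dvd (by omega) h
      simp at hi; omega
    by_cases hk : k < p
    · rw [sum_eq_zero]
      · exact sum_nonneg fun i _ => h0 _
      · intro i hi
        simp at hi
        rw [if_neg (hd i (by simp; omega))]
    · obtain ⟨m, rfl⟩ : ∃ m, k = p + m := ⟨k - p, by omega⟩
      rw [sum_range_add, sum_range_add]
      refine add_le_add ?_ ?_
      · obtain ⟨q, rfl⟩ : ∃ q, p = q + 1 := ⟨p - 1, by omega⟩
        rw [sum_range_succ, sum_eq_zero fun i hi => by rw [if_neg (hd i (by simpa using hi))],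
          zero_add, if_pos dvd_rfl]
        have : ∑ i ∈ range (q + 1), u (q + 1 + m - 1 - q) ≤
            ∑ i ∈ range (q + 1), u (q + 1 + m - 1 - i) :=
          sum_le_sum fun i hi => hu (by simp at hi; omega)
        simpa using this
      · have := ih m (by omega)
        have e : ∀ i, p ∣ p + i + 1 ↔ p ∣ i + 1 := fun i => by rw [add_assoc]; simp
        have e' : ∀ i, p + m - 1 - (p + i) = m - 1 - i := fun i => by omega
        simpa only [e, e'] using this

/-- The sieve bound: if the power sums of `s` are at most `A`, except for the exponents divisible
by `p` where they are at most `B`, then the elementary symmetric functions of `s` are bounded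
by a binomial coefficient. -/
theorem norm_esymm_le_realChoose (s : Multiset ℂ) (p : ℕ) (hp : 0 < p) (A B : ℝ) (hA : 1 ≤ A)
    (hAB : A ≤ B) (hs : ∀ i, 0 < i → ‖powerSum s i‖ ≤ if p ∣ i then B else A) (k : ℕ) :
    ‖s.esymm k‖ ≤ realChoose (B / p + (1 - 1 / p) * A + k - 1) k := by
  set M := B / p + (1 - 1 / p) * A with hM
  have hp' : (0 : ℝ) < p := by positivity
  have hMA : M = A + (B - A) / p := by rw [hM]; field_simp; ring
  have hM1 : 1 ≤ M := by
    rw [hMA]; have : 0 ≤ (B - A) / p := div_nonneg (by linarith) hp'.le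
    linarith
  set u : ℕ → ℝ := fun k => realChoose (M + k - 1) k with hu
  have hmono : Monotone u := realChoose_monotone M hM1
  have hpos : ∀ k, 0 ≤ u k := fun k => (realChoose_pos M (by linarith) k).le
  change _ ≤ u k
  induction k using Nat.strong_induction_on with
  | _ k ih =>
    rcases Nat.eq_zero_or_pos k with rfl | hk
    · simp [hu, realChoose, Multiset.esymm]
    have hk' : (0 : ℝ) < k := by exact_mod_cast hk
    refine le_of_mul_le_mul_left ?_ hk'
    have h1 : (k : ℝ) * ‖s.esymm k‖ ≤
        ∑ i ∈ range k, (if p ∣ i + 1 then B else A) * u (k - 1 - i) := by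
      have := congrArg norm (mul_signed_esymm_eq s k)
      rw [norm_neg] at this
      simp only [norm_mul, norm_pow, norm_neg, norm_one, one_pow, one_mul,
        Complex.norm_natCast] at this
      rw [this]
      refine (norm_sum_le _ _).trans (sum_le_sum fun i hi => ?_)
      simp only [norm_mul, norm_pow, norm_neg, norm_one, one_pow, one_mul]
      have h3 := hs (i + 1) (by omega)
      exact mul_le_mul h3 (ih _ (by simp at hi; omega)) (norm_nonneg _)
        ((norm_nonneg _).trans h3)
    refine h1.trans ?_
    have h2 : ∑ i ∈ range k, (if p ∣ i + 1 then B else A) * u (k - 1 - i) =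
        A * ∑ i ∈ range k, u (k - 1 - i) + (B - A) / p *
          ∑ i ∈ range k, (if p ∣ i + 1 then (p : ℝ) * u (k - 1 - i) else 0) := by
      rw [mul_sum, mul_sum, ← sum_add_distrib]
      refine sum_congr rfl fun i _ => ?_
      split_ifs
      · field_simp; ring
      · ring
    rw [h2]
    have h4 : (k : ℝ) * u k = M * ∑ i ∈ range k, u (k - 1 - i) := mul_realChoose_eq_sum M k
    rw [h4, hMA, add_mul]
    exact add_le_add_right (mul_le_mul_of_nonneg_left (sum_dvd_le_sum p hp u hmono hpos k)
      (div_nonneg (sub_nonneg.2 hAB) hp'.le)) _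

theorem addChar_map_sum {ι A M : Type*} [AddCommMonoid A] [CommMonoid M] (ψ : AddChar A M)
    (s : Finset ι) (g : ι → A) : ψ (∑ i ∈ s, g i) = ∏ i ∈ s, ψ (g i) := by
  classical
  induction s using Finset.induction_on with
  | empty => simp
  | insert a s ha ih => rw [sum_insert ha, prod_insert ha, AddChar.map_add_eq_mul, ih]

theorem abs_polySubsetSumCount_sub_le (n : ℕ) [NeZero n] (D : Finset (ZMod n))
    (f : Polynomial (ZMod n)) (k : ℕ) (b : ZMod n) (B : ℝ) (hB0 : 0 ≤ B)
    (hB : ∀ j : ZMod n, j ≠ 0 →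
      ‖(D.val.map fun x => ZMod.stdAddChar (j * f.eval x)).esymm k‖ ≤ B) :
    |(polySubsetSumCount D f k b : ℝ) - 1 / n * (D.card.choose k : ℝ)| ≤ B := by
  have hn : (n : ℝ) ≠ 0 := by simp [NeZero.ne n]
  set E : ZMod n → ℂ := fun j => (D.val.map fun x => ZMod.stdAddChar (j * f.eval x)).esymm k
  have hE : ∀ j, E j = ∑ S ∈ D.powersetCard k, ZMod.stdAddChar (j * ∑ x ∈ S, f.eval x) := by
    intro j
    simp only [E]
    rw [Finset.esymm_map_val]
    refine sum_congr rfl fun S _ => ?_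
    rw [mul_sum, addChar_map_sum]
  have hE0 : E 0 = (D.card.choose k : ℂ) := by rw [hE]; simp
  have key : (n : ℂ) * (polySubsetSumCount D f k b : ℂ) =
      ∑ j : ZMod n, ZMod.stdAddChar (-(j * b)) * E j := by
    simp only [hE]
    rw [sum_congr rfl fun j _ => mul_sum _ _ _]
    simp only [← AddChar.map_add_eq_mul]
    rw [sum_comm, polySubsetSumCount, card_filter, Nat.cast_sum, mul_sum]
    refine sum_congr rfl fun S _ => ?_
    have := AddChar.sum_mulShift (R := ZMod n) (R' := ℂ) (ψ := ZMod.stdAddChar)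
      (∑ x ∈ S, f.eval x - b) (ZMod.isPrimitive_stdAddChar n)
    rw [show (∑ j : ZMod n, (ZMod.stdAddChar (-(j * b) + j * ∑ x ∈ S, f.eval x) : ℂ)) =
      ∑ j : ZMod n, ZMod.stdAddChar (j * (∑ x ∈ S, f.eval x - b)) from
        sum_congr rfl fun j _ => by congr 1; ring, this]
    simp [sub_eq_zero]
  have h2 : (n : ℂ) * (polySubsetSumCount D f k b : ℂ) - (D.card.choose k : ℂ) =
      ∑ j ∈ univ.erase (0 : ZMod n), ZMod.stdAddChar (-(j * b)) * E j := by
    rw [key, ← add_sum_erase _ _ (mem_univ (0 : ZMod n)), hE0]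
    simp
  have hn1 : 1 ≤ n := NeZero.one_le
  have h3 : ‖(n : ℂ) * (polySubsetSumCount D f k b : ℂ) - (D.card.choose k : ℂ)‖ ≤
      (n - 1 : ℕ) * B := by
    rw [h2]
    refine (norm_sum_le _ _).trans ?_
    have : ((univ.erase (0 : ZMod n)).card) = n - 1 := by
      rw [card_erase_of_mem (mem_univ _), card_univ, ZMod.card]
    rw [← this, ← nsmul_eq_mul]
    refine sum_le_card_nsmul _ _ _ fun j hj => ?_
    rw [norm_mul, AddChar.norm_apply, one_mul]
    exact hB j (ne_of_mem_erase hj)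
  have h4 : ‖(n : ℂ) * (polySubsetSumCount D f k b : ℂ) - (D.card.choose k : ℂ)‖ =
      n * |(polySubsetSumCount D f k b : ℝ) - 1 / n * (D.card.choose k : ℝ)| := by
    have e : (n : ℂ) * (polySubsetSumCount D f k b : ℂ) - (D.card.choose k : ℂ) =
        ((n * ((polySubsetSumCount D f k b : ℝ) - 1 / n * (D.card.choose k : ℝ)) : ℝ) : ℂ) := by
      rw [mul_sub, ← mul_assoc, mul_one_div_cancel hn]
      push_cast; ring
    rw [e, Complex.norm_real, norm_mul, Real.norm_natCast, Real.norm_eq_abs]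
  rw [h4] at h3
  have h5 : ((n - 1 : ℕ) : ℝ) * B ≤ n * B := by gcongr; omega
  exact le_of_mul_le_mul_left (h3.trans h5) (by positivity)

theorem finite_natDegree_le (K : Type*) [Field K] [Finite K] (m : ℕ) :
    {g : Polynomial K | g.natDegree ≤ m}.Finite := by
  have : Finite (Polynomial.degreeLT K (m + 1)) :=
    Finite.of_equiv _ (Polynomial.degreeLTEquiv K (m + 1)).toEquiv.symm
  refine (Set.toFinite (Polynomial.degreeLT K (m + 1) : Set (Polynomial K))).subset fun g hg => ?_
  rw [SetLike.mem_coe, Polynomial.mem_degreeLT]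
  exact Polynomial.degree_le_natDegree.trans_lt (by
    exact_mod_cast Nat.lt_succ_of_le (show g.natDegree ≤ m from hg))

/-- The monic polynomials of degree `m` over a finite field. -/
noncomputable def monicDeg (K : Type*) [Field K] [Finite K] (m : ℕ) : Finset (Polynomial K) :=
  ((finite_natDegree_le K m).subset (t := {g | g.Monic ∧ g.natDegree = m})
    fun _ h => h.2.le).toFinset

/-- The monic irreducible polynomials of degree at most `m` over a finite field. -/
noncomputable def monicIrr (K : Type*) [Field K] [Finite K] (m : ℕ) : Finset (Polynomial K) :=
  ((finite_natDegree_le K m).subset (t := {g | g.Monic ∧ Irreducible g ∧ g.natDegree ≤ m})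
    fun _ h => h.2.2).toFinset

section
variable {K : Type*} [Field K] [Finite K]

theorem mem_monicDeg {m : ℕ} {g : Polynomial K} :
    g ∈ monicDeg K m ↔ g.Monic ∧ g.natDegree = m := by simp [monicDeg]

theorem mem_monicIrr {m : ℕ} {g : Polynomial K} :
    g ∈ monicIrr K m ↔ g.Monic ∧ Irreducible g ∧ g.natDegree ≤ m := by simp [monicIrr]

open Classical in
/-- The degree of `g` is the total degree of its irreducible factors, with multiplicity. -/
theorem sum_natDegree_prime_powers_dvd {m : ℕ} {g : Polynomial K} (hg : g ∈ monicDeg K m) :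
    ∑ P ∈ monicIrr K m, ∑ k ∈ Icc 1 m, (if P ^ k ∣ g then P.natDegree else 0) = m := by
  obtain ⟨hm, rfl⟩ := mem_monicDeg.1 hg
  have hg0 := hm.ne_zero
  have hprod : (UniqueFactorizationMonoid.normalizedFactors g).prod = g := by
    have := UniqueFactorizationMonoid.prod_normalizedFactors_eq hg0
    rwa [hm.normalize_eq_self] at this
  have hdeg : ((UniqueFactorizationMonoid.normalizedFactors g).map Polynomial.natDegree).sum
      = g.natDegree := by
    conv_rhs => rw [← hprod]
    rw [Polynomial.natDegree_multiset_prod]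
    exact UniqueFactorizationMonoid.zero_notMem_normalizedFactors g
  have hsub : (UniqueFactorizationMonoid.normalizedFactors g).toFinset ⊆ monicIrr K g.natDegree := by
    intro P hP
    rw [Multiset.mem_toFinset] at hP
    refine mem_monicIrr.2 ⟨?_, UniqueFactorizationMonoid.irreducible_of_normalized_factor P hP,
      Polynomial.natDegree_le_of_dvd
        (UniqueFactorizationMonoid.dvd_of_mem_normalizedFactors hP) hg0⟩
    have h0 := (UniqueFactorizationMonoid.irreducible_of_normalized_factor P hP).ne_zero
    have := UniqueFactorizationMonoid.normalize_normalized_factor P hP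
    rw [← this]
    exact Polynomial.monic_normalize h0
  conv_rhs => rw [← hdeg]
  rw [Finset.sum_multiset_map_count]
  rw [← sum_subset hsub]
  · refine sum_congr rfl fun P hP => ?_
    rw [Multiset.mem_toFinset] at hP
    have hirr := UniqueFactorizationMonoid.irreducible_of_normalized_factor P hP
    have hPm := (mem_monicIrr.1 (hsub (Multiset.mem_toFinset.2 hP))).1
    rw [← sum_filter, sum_const, smul_eq_mul, smul_eq_mul]
    congr 1
    have hiff : ∀ k, P ^ k ∣ g ↔ k ≤ (UniqueFactorizationMonoid.normalizedFactors g).count P := by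
      intro k
      have h := UniqueFactorizationMonoid.emultiplicity_eq_count_normalizedFactors hirr hg0
      rw [hPm.normalize_eq_self] at h
      rw [pow_dvd_iff_le_emultiplicity, h]
      exact_mod_cast Iff.rfl
    have hle : (UniqueFactorizationMonoid.normalizedFactors g).count P ≤ g.natDegree := by
      have h1 := Polynomial.natDegree_le_of_dvd ((hiff _).2 le_rfl) hg0
      rw [Polynomial.natDegree_pow] at h1
      have h2 := hirr.natDegree_pos
      nlinarith
    have : {k ∈ Icc 1 g.natDegree | P ^ k ∣ g} =
        Icc 1 ((UniqueFactorizationMonoid.normalizedFactors g).count P) := by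
      ext k
      simp only [mem_filter, mem_Icc, hiff]
      omega
    rw [this]; simp
  · intro P hP hP2
    refine sum_eq_zero fun k hk => if_neg fun hd => hP2 ?_
    obtain ⟨hPm, hirr, -⟩ := mem_monicIrr.1 hP
    have hdvd : P ∣ g := (dvd_pow_self P (by simp at hk; omega)).trans hd
    obtain ⟨q, hq, hPq⟩ :=
      UniqueFactorizationMonoid.exists_mem_normalizedFactors_of_dvd hg0 hirr hdvd
    have hqm := (mem_monicIrr.1 (hsub (Multiset.mem_toFinset.2 hq))).1
    rwa [Multiset.mem_toFinset, Polynomial.eq_of_monic_of_associated hPm hqm hPq]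

/-- The sum over monic polynomials of degree `m` of a function. -/
noncomputable def monicSum (χ : Polynomial K → ℂ) (m : ℕ) : ℂ := ∑ g ∈ monicDeg K m, χ g

/-- The prime power sums attached to a multiplicative function on monic polynomials. -/
noncomputable def primeSum (χ : Polynomial K → ℂ) (j : ℕ) : ℂ :=
  ∑ P ∈ monicIrr K j, if P.natDegree ∣ j then (P.natDegree : ℂ) * χ P ^ (j / P.natDegree) else 0

theorem map_pow_of_monic {K : Type*} [Field K] {χ : Polynomial K → ℂ} (h1 : χ 1 = 1)
    (hmul : ∀ g h : Polynomial K, g.Monic → h.Monic → χ (g * h) = χ g * χ h)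
    (P : Polynomial K) (hP : P.Monic) (k : ℕ) : χ (P ^ k) = χ P ^ k := by
  induction k with
  | zero => simpa using h1
  | succ k ih => rw [pow_succ, pow_succ, hmul _ _ (hP.pow k) hP, ih]

open Classical in
theorem sum_dvd_monicDeg {χ : Polynomial K → ℂ} (h1 : χ 1 = 1)
    (hmul : ∀ g h : Polynomial K, g.Monic → h.Monic → χ (g * h) = χ g * χ h)
    (P : Polynomial K) (hP : P.Monic) (k m : ℕ) :
    ∑ g ∈ monicDeg K m, (if P ^ k ∣ g then χ g else 0) =
      if k * P.natDegree ≤ m then χ P ^ k * monicSum χ (m - k * P.natDegree) else 0 := by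
  have hPk := hP.pow k
  have hdeg : (P ^ k).natDegree = k * P.natDegree := hP.natDegree_pow k
  rw [← sum_filter]
  split_ifs with h
  · rw [monicSum, mul_sum]
    symm
    refine sum_bij (fun g _ => P ^ k * g) ?_ ?_ ?_ ?_
    · intro g hg
      obtain ⟨hm, hd⟩ := mem_monicDeg.1 hg
      refine mem_filter.2 ⟨mem_monicDeg.2 ⟨hPk.mul hm, ?_⟩, dvd_mul_right _ _⟩
      rw [hPk.natDegree_mul hm, hdeg, hd]; omega
    · intro a _ b _ hab
      exact mul_left_cancel₀ hPk.ne_zero hab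
    · intro g hg
      obtain ⟨hg, q, rfl⟩ := mem_filter.1 hg
      obtain ⟨hm, hd⟩ := mem_monicDeg.1 hg
      have hq := hPk.of_mul_monic_left hm
      rw [hPk.natDegree_mul hq, hdeg] at hd
      exact ⟨q, mem_monicDeg.2 ⟨hq, by omega⟩, rfl⟩
    · intro g hg
      rw [hmul _ _ hPk (mem_monicDeg.1 hg).1, map_pow_of_monic h1 hmul P hP]
  · refine sum_eq_zero fun g hg => ?_
    obtain ⟨hg, hd⟩ := mem_filter.1 hg
    obtain ⟨hm, rfl⟩ := mem_monicDeg.1 hg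
    have := Polynomial.natDegree_le_of_dvd hd hm.ne_zero
    omega

/-- The logarithmic derivative of the Euler product, coefficientwise. -/
theorem mul_monicSum_eq {χ : Polynomial K → ℂ} (h1 : χ 1 = 1)
    (hmul : ∀ g h : Polynomial K, g.Monic → h.Monic → χ (g * h) = χ g * χ h)
    (m : ℕ) :
    (m : ℂ) * monicSum χ m = ∑ i ∈ range m, primeSum χ (i + 1) * monicSum χ (m - 1 - i) := by
  classical
  have hL : (m : ℂ) * monicSum χ m = ∑ P ∈ monicIrr K m, ∑ k ∈ Icc 1 m,
      if k * P.natDegree ≤ m then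
        (P.natDegree : ℂ) * (χ P ^ k * monicSum χ (m - k * P.natDegree)) else 0 := by
    rw [monicSum, mul_sum]
    have : ∀ g ∈ monicDeg K m, (m : ℂ) * χ g = ∑ P ∈ monicIrr K m, ∑ k ∈ Icc 1 m,
        (P.natDegree : ℂ) * (if P ^ k ∣ g then χ g else 0) := by
      intro g hg
      conv_lhs => rw [← sum_natDegree_prime_powers_dvd hg]
      push_cast
      rw [sum_mul]
      refine sum_congr rfl fun P _ => ?_
      rw [sum_mul]
      refine sum_congr rfl fun k _ => ?_
      split_ifs <;> simp
    rw [sum_congr rfl this, sum_comm]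
    refine sum_congr rfl fun P hP => ?_
    rw [sum_comm]
    refine sum_congr rfl fun k _ => ?_
    rw [← mul_sum, sum_dvd_monicDeg h1 hmul P (mem_monicIrr.1 hP).1]
    split_ifs <;> simp
  have hR : ∑ i ∈ range m, primeSum χ (i + 1) * monicSum χ (m - 1 - i) =
      ∑ P ∈ monicIrr K m, ∑ i ∈ range m, if P.natDegree ∣ i + 1 then
        (P.natDegree : ℂ) * χ P ^ ((i + 1) / P.natDegree) * monicSum χ (m - 1 - i) else 0 := by
    rw [sum_comm]
    refine sum_congr rfl fun i hi => ?_
    have hi := mem_range.1 hi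
    have hz : ∀ P ∈ monicIrr K m, P ∉ monicIrr K (i + 1) → (if P.natDegree ∣ i + 1 then
        (P.natDegree : ℂ) * χ P ^ ((i + 1) / P.natDegree) * monicSum χ (m - 1 - i) else 0) = 0 := by
      intro P hP hP2
      obtain ⟨a, b, c⟩ := mem_monicIrr.1 hP
      exact if_neg fun hd => hP2 (mem_monicIrr.2 ⟨a, b, Nat.le_of_dvd (by omega) hd⟩)
    rw [primeSum, sum_mul]
    rw [← sum_subset _ hz]
    · refine sum_congr rfl fun P _ => ?_
      split_ifs <;> simp
    · intro P hP
      obtain ⟨a, b, c⟩ := mem_monicIrr.1 hP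
      exact mem_monicIrr.2 ⟨a, b, by omega⟩
  rw [hL, hR]
  refine sum_congr rfl fun P hP => ?_
  have hpos := (mem_monicIrr.1 hP).2.1.natDegree_pos
  rw [← sum_filter, ← sum_filter]
  refine sum_bij (fun k _ => k * P.natDegree - 1) ?_ ?_ ?_ ?_
  · intro k hk
    simp only [mem_filter, mem_Icc, mem_range] at hk ⊢
    have : 0 < k * P.natDegree := by have := hk.1.1; positivity
    refine ⟨by omega, ?_⟩
    rw [Nat.sub_add_cancel this]; exact dvd_mul_left _ _
  · intro a ha b hb hab
    simp only [mem_filter, mem_Icc] at ha hb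
    have h1 : 0 < a * P.natDegree := by have := ha.1.1; positivity
    have h2 : 0 < b * P.natDegree := by have := hb.1.1; positivity
    exact Nat.eq_of_mul_eq_mul_right hpos (by omega)
  · intro i hi
    simp only [mem_filter, mem_range] at hi
    obtain ⟨hi, k, hk⟩ := hi
    have hk0 : 1 ≤ k := by rcases Nat.eq_zero_or_pos k with rfl | h <;> omega
    refine ⟨k, ?_, ?_⟩
    · simp only [mem_filter, mem_Icc]
      have : k ≤ k * P.natDegree := Nat.le_mul_of_pos_right _ hpos
      rw [mul_comm] at hk
      omega
    · rw [mul_comm] at hk; omega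
  · intro k hk
    simp only [mem_filter, mem_Icc] at hk
    have : 0 < k * P.natDegree := by have := hk.1.1; positivity
    rw [Nat.sub_add_cancel this, Nat.mul_div_cancel _ hpos, mul_assoc,
      show m - 1 - (k * P.natDegree - 1) = m - k * P.natDegree by omega]

end

/-- The sum of the values of `f` at the roots of `g` in `E`. -/
noncomputable def rootSum {K : Type*} (E : Type*) [Field K] [Field E] [Algebra K E]
    (f g : Polynomial K) : E :=
  ((g.aroots E).map fun α => Polynomial.aeval α f).sum

theorem rootSum_one {K E : Type*} [Field K] [Field E] [Algebra K E] (f : Polynomial K) :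
    rootSum E f 1 = 0 := by simp [rootSum]

theorem rootSum_mul {K E : Type*} [Field K] [Field E] [Algebra K E] (f : Polynomial K)
    {g h : Polynomial K} (hg : g ≠ 0) (hh : h ≠ 0) :
    rootSum E f (g * h) = rootSum E f g + rootSum E f h := by
  rw [rootSum, Polynomial.aroots_mul (mul_ne_zero hg hh)]; simp [rootSum]

theorem rootSum_eq_sum_powerSum {K E : Type*} [Field K] [Field E] [Algebra K E]
    (f g : Polynomial K) :
    rootSum E f g = ∑ i ∈ range (f.natDegree + 1),
      algebraMap K E (f.coeff i) * powerSum (g.aroots E) i := by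
  rw [rootSum]
  simp only [Polynomial.aeval_eq_sum_range, powerSum, Algebra.smul_def,
    ← Multiset.sum_map_mul_left]
  exact Multiset.sum_map_sum_map _ _

theorem neg_one_pow_mul_esymm_aroots {K E : Type*} [Field K] [Field E] [Algebra K E]
    [IsAlgClosed E] {g : Polynomial K} (hg : g.Monic) {j : ℕ} (hj : j ≤ g.natDegree) :
    (-1) ^ j * (g.aroots E).esymm j = algebraMap K E (g.coeff (g.natDegree - j)) := by
  have hm : (g.map (algebraMap K E)).Monic := hg.map _
  have hd : (g.map (algebraMap K E)).natDegree = g.natDegree := hg.natDegree_map _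
  have h := Polynomial.coeff_eq_esymm_roots_of_card
    (IsAlgClosed.splits (g.map (algebraMap K E))).natDegree_eq_card_roots.symm
    (k := g.natDegree - j) (by omega)
  rw [hd, hm.leadingCoeff, one_mul, Nat.sub_sub_self hj, Polynomial.coeff_map] at h
  rw [h, Polynomial.aroots]

theorem add_C_mul_X_pow_mem_monicDeg {K : Type*} [Field K] [Finite K] {m e : ℕ} (he : 0 < e)
    (hme : e ≤ m) {g : Polynomial K} (hg : g ∈ monicDeg K m) (a : K) :
    g + Polynomial.C a * Polynomial.X ^ (m - e) ∈ monicDeg K m := by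
  obtain ⟨hm, hd⟩ := mem_monicDeg.1 hg
  have hlt : (Polynomial.C a * Polynomial.X ^ (m - e)).degree < g.degree := by
    rw [Polynomial.degree_eq_natDegree hm.ne_zero, hd]
    refine (Polynomial.degree_C_mul_X_pow_le _ _).trans_lt ?_
    exact_mod_cast (by omega : m - e < m)
  refine mem_monicDeg.2 ⟨hm.add_of_left hlt, ?_⟩
  rw [Polynomial.natDegree_add_eq_left_of_degree_lt hlt, hd]

theorem rootSum_add_C_mul_X_pow {K E : Type*} [Field K] [Finite K] [Field E] [Algebra K E]
    [IsAlgClosed E] {f : Polynomial K} {m : ℕ} (he : 0 < f.natDegree) (hme : f.natDegree ≤ m)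
    {g : Polynomial K} (hg : g ∈ monicDeg K m) (a : K) :
    rootSum E f (g + Polynomial.C a * Polynomial.X ^ (m - f.natDegree)) =
      rootSum E f g - algebraMap K E (f.leadingCoeff * f.natDegree * a) := by
  set e := f.natDegree with hedef
  have hg' := add_C_mul_X_pow_mem_monicDeg he hme hg a
  set g' := g + Polynomial.C a * Polynomial.X ^ (m - e) with hg'def
  obtain ⟨hm, hd⟩ := mem_monicDeg.1 hg
  obtain ⟨hm', hd'⟩ := mem_monicDeg.1 hg'
  have hco : ∀ j ≤ m, (-1 : E) ^ j * (g'.aroots E).esymm j =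
      (-1) ^ j * (g.aroots E).esymm j + if j = e then algebraMap K E a else 0 := by
    intro j hj
    rw [neg_one_pow_mul_esymm_aroots hm' (by omega), neg_one_pow_mul_esymm_aroots hm (by omega),
      hd, hd', hg'def, Polynomial.coeff_add, Polynomial.coeff_C_mul_X_pow, map_add]
    congr 1
    by_cases h : j = e
    · simp [h]
    · rw [if_neg h, if_neg (by omega), map_zero]
  have hlow : ∀ j < e, (g'.aroots E).esymm j = (g.aroots E).esymm j := by
    intro j hj
    have h := hco j (by omega)
    rw [if_neg (by omega), add_zero] at h
    exact mul_left_cancel₀ (by simp) h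
  have htop := powerSum_sub_of_signed_esymm_eq _ _ e he hlow
  rw [hco e hme, if_pos rfl, add_sub_cancel_left] at htop
  rw [rootSum_eq_sum_powerSum, rootSum_eq_sum_powerSum, sum_range_succ, sum_range_succ,
    ← hedef, htop]
  have : ∀ i ∈ range e, algebraMap K E (f.coeff i) * powerSum (g'.aroots E) i =
      algebraMap K E (f.coeff i) * powerSum (g.aroots E) i := by
    intro i hi
    rcases Nat.eq_zero_or_pos i with rfl | hi0
    · have h1 := (IsAlgClosed.splits (g.map (algebraMap K E))).natDegree_eq_card_roots
      have h2 := (IsAlgClosed.splits (g'.map (algebraMap K E))).natDegree_eq_card_roots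
      rw [hm.natDegree_map, hd] at h1
      rw [hm'.natDegree_map, hd'] at h2
      simp [powerSum, Polynomial.aroots, ← h1, ← h2]
    · rw [powerSum_eq_of_signed_esymm_eq _ _ e hlow i (mem_range.1 hi) hi0]
  rw [sum_congr rfl this, Polynomial.leadingCoeff, ← hedef]
  simp only [map_mul, map_natCast]
  ring

/-- A function of monic polynomials, defined by an additive character evaluated at the sum of the
values of `f` at the roots. -/
noncomputable def polyChar {K E : Type*} [Field K] [Field E] [Algebra K E] (ψ : AddChar K ℂ)
    (π : E →ₗ[K] K) (f g : Polynomial K) : ℂ := ψ (π (rootSum E f g))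

theorem polyChar_one {K E : Type*} [Field K] [Field E] [Algebra K E] (ψ : AddChar K ℂ)
    (π : E →ₗ[K] K) (f : Polynomial K) : polyChar ψ π f 1 = 1 := by
  simp [polyChar, rootSum_one]

theorem polyChar_mul {K E : Type*} [Field K] [Field E] [Algebra K E] (ψ : AddChar K ℂ)
    (π : E →ₗ[K] K) (f g h : Polynomial K) (hg : g.Monic) (hh : h.Monic) :
    polyChar ψ π f (g * h) = polyChar ψ π f g * polyChar ψ π f h := by
  simp [polyChar, rootSum_mul f hg.ne_zero hh.ne_zero, AddChar.map_add_eq_mul]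

theorem monicSum_polyChar_eq_zero {K E : Type*} [Field K] [Finite K] [Field E] [Algebra K E]
    [IsAlgClosed E] {ψ : AddChar K ℂ} (hψ : ψ ≠ 1) {π : E →ₗ[K] K}
    (hπ : ∀ a, π (algebraMap K E a) = a) {f : Polynomial K} (he : (f.natDegree : K) ≠ 0) {m : ℕ}
    (hme : f.natDegree ≤ m) : monicSum (polyChar ψ π f) m = 0 := by
  have he0 : 0 < f.natDegree := Nat.pos_of_ne_zero fun h => he (by simp [h])
  have hf0 : f.leadingCoeff ≠ 0 := by
    rw [Polynomial.leadingCoeff_ne_zero]; rintro rfl; simp at he0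
  obtain ⟨u, hu⟩ := AddChar.ne_one_iff.1 hψ
  set κ := f.leadingCoeff * f.natDegree with hκ
  have hκ0 : κ ≠ 0 := mul_ne_zero hf0 he
  set a := -(u / κ) with ha
  have hinv : ∀ (b : K), ∀ g ∈ monicDeg K m,
      g + Polynomial.C b * Polynomial.X ^ (m - f.natDegree) ∈ monicDeg K m :=
    fun b g hg => add_C_mul_X_pow_mem_monicDeg he0 hme hg b
  have hsum : monicSum (polyChar ψ π f) m = ψ u * monicSum (polyChar ψ π f) m := by
    conv_rhs => rw [monicSum, mul_sum]
    rw [monicSum]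
    refine (sum_bij' (fun g _ => g + Polynomial.C a * Polynomial.X ^ (m - f.natDegree))
      (fun g _ => g + Polynomial.C (-a) * Polynomial.X ^ (m - f.natDegree))
      (hinv a) (hinv (-a)) ?_ ?_ ?_).symm
    · intro g _; simp
    · intro g _; simp
    · intro g hg
      rw [polyChar, polyChar, rootSum_add_C_mul_X_pow he0 hme hg, map_sub, hπ,
        ← AddChar.map_add_eq_mul]
      congr 1
      rw [← hκ, ha, mul_neg, mul_div_cancel₀ _ hκ0]; ring
  have : (1 - ψ u) * monicSum (polyChar ψ π f) m = 0 := by linear_combination hsum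
  exact (mul_eq_zero.1 this).resolve_left (sub_ne_zero.2 (Ne.symm hu))

open IntermediateField in
/-- The trace of `f x` is a multiple of the sum of `f` over the conjugates of `x`. -/
theorem algebraMap_trace_aeval {K L E : Type*} [Field K] [Field L] [Field E] [Algebra K L]
    [Algebra K E] [IsAlgClosed E] [FiniteDimensional K L] [Algebra.IsSeparable K L]
    (f : Polynomial K) (x : L) :
    algebraMap K E (Algebra.trace K L (Polynomial.aeval x f)) =
      (Module.finrank K⟮x⟯ L) • rootSum E f (minpoly K x) := by
  classical
  have hx := Algebra.IsSeparable.isIntegral K x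
  set pb := adjoin.powerBasis hx with hpb
  have hsep := Algebra.isSeparable_tower_bot_of_isSeparable K K⟮x⟯ L
  have hgen : pb.gen = AdjoinSimple.gen K x := adjoin.powerBasis_gen hx
  have hval : Polynomial.aeval x f =
      algebraMap K⟮x⟯ L (Polynomial.aeval pb.gen f) := by
    rw [← Polynomial.aeval_algebraMap_apply, hgen, AdjoinSimple.algebraMap_gen]
  have hmin : minpoly K pb.gen = minpoly K x := by rw [hgen, minpoly_gen]
  rw [hval, ← Algebra.trace_trace (S := K⟮x⟯), Algebra.trace_algebraMap, map_nsmul, map_nsmul,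
    trace_eq_sum_embeddings E]
  congr 1
  rw [rootSum, ← hmin,
    Finset.sum_congr rfl fun σ _ => (Polynomial.aeval_algHom_apply σ pb.gen f).symm]
  rw [Fintype.sum_equiv pb.liftEquiv' (fun σ : K⟮x⟯ →ₐ[K] E => Polynomial.aeval (σ pb.gen) f)
    (fun y => Polynomial.aeval (y : E) f) (fun σ => by rw [PowerBasis.liftEquiv'_apply_coe]),
    Finset.sum_mem_multiset _ _ (fun y => Polynomial.aeval y f) (fun _ => rfl),
    Finset.sum_eq_multiset_sum, Multiset.toFinset_val, Multiset.dedup_eq_self.mpr _]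
  exact Polynomial.nodup_roots ((Polynomial.separable_map _).mpr
    (Algebra.IsSeparable.isSeparable K _))

open Classical in
theorem card_minpoly_eq {K L : Type*} [Field K] [Finite K] [Field L] [Fintype L] [Algebra K L]
    {P : Polynomial K} (hm : P.Monic) (hP : Irreducible P)
    (hd : P.natDegree ∣ Module.finrank K L) :
    #{x : L | minpoly K x = P} = P.natDegree := by
  have hfin : Module.finrank K L ≠ 0 := (Module.finrank_pos (R := K) (M := L)).ne'
  have hdvd := (hP.natDegree_dvd_iff_dvd_X_pow_card_pow_sub_X).1 hd
  rw [← Module.natCard_eq_pow_finrank (K := K) (V := L), Nat.card_eq_fintype_card] at hdvd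
  have hsplit : (P.map (algebraMap K L)).Splits := by
    have h := (FiniteField.isSplittingField_sub L K).splits
    refine h.of_dvd ?_ (Polynomial.map_dvd _ hdvd)
    rw [Polynomial.map_ne_zero_iff (algebraMap K L).injective]
    exact FiniteField.X_pow_card_sub_X_ne_zero K Fintype.one_lt_card
  have hsep : P.Separable := PerfectField.separable_of_irreducible hP
  rw [← Polynomial.card_rootSet_eq_natDegree hsep hsplit, ← Set.toFinset_card]
  congr 1
  ext x
  simp only [mem_filter, mem_univ, true_and, Set.mem_toFinset,
    Polynomial.mem_rootSet_of_ne hm.ne_zero]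
  constructor
  · rintro rfl; exact minpoly.aeval K x
  · intro h; exact (minpoly.eq_of_irreducible_of_monic hP h hm).symm

open IntermediateField in
/-- Sums of additive characters over an extension field, as prime power sums. -/
theorem sum_addChar_trace_aeval {K L E : Type*} [Field K] [Finite K] [Field L] [Fintype L]
    [Algebra K L] [Field E] [Algebra K E] [IsAlgClosed E] (ψ : AddChar K ℂ) {π : E →ₗ[K] K}
    (hπ : ∀ a, π (algebraMap K E a) = a) (f : Polynomial K) :
    ∑ x : L, ψ (Algebra.trace K L (Polynomial.aeval x f)) =
      primeSum (polyChar ψ π f) (Module.finrank K L) := by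
  classical
  have hfin : 0 < Module.finrank K L := Module.finrank_pos
  have hint : ∀ x : L, IsIntegral K x := Algebra.IsIntegral.isIntegral
  have hdeg : ∀ x : L, (minpoly K x).natDegree * Module.finrank K⟮x⟯ L = Module.finrank K L := by
    intro x
    rw [← adjoin.finrank (hint x), Module.finrank_mul_finrank]
  have hmaps : ∀ x ∈ (univ : Finset L), minpoly K x ∈ monicIrr K (Module.finrank K L) :=
    fun x _ => mem_monicIrr.2 ⟨minpoly.monic (hint x), minpoly.irreducible (hint x),
      Nat.le_of_dvd hfin ⟨_, (hdeg x).symm⟩⟩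
  rw [← sum_fiberwise_of_maps_to hmaps, primeSum]
  refine sum_congr rfl fun P hP => ?_
  obtain ⟨hm, hirr, -⟩ := mem_monicIrr.1 hP
  have hval : ∀ x ∈ (univ : Finset L).filter (fun x => minpoly K x = P),
      ψ (Algebra.trace K L (Polynomial.aeval x f)) =
        polyChar ψ π f P ^ (Module.finrank K L / P.natDegree) := by
    intro x hx
    have hx := (mem_filter.1 hx).2
    have h1 : Module.finrank K L / P.natDegree = Module.finrank K⟮x⟯ L := by
      rw [← hdeg x, hx, Nat.mul_div_cancel_left _ hirr.natDegree_pos]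
    rw [← hπ (Algebra.trace K L (Polynomial.aeval x f)), algebraMap_trace_aeval (E := E), hx,
      map_nsmul, AddChar.map_nsmul_eq_pow, h1, polyChar]
  rw [sum_congr rfl hval, sum_const, nsmul_eq_mul]
  split_ifs with hd
  · rw [card_minpoly_eq hm hirr hd]
  · have : (univ : Finset L).filter (fun x => minpoly K x = P) = ∅ := by
      refine filter_eq_empty_iff.2 fun x _ hx => hd ?_
      exact ⟨_, hx ▸ (hdeg x).symm⟩
    rw [this]; simp

/-- Character sums over extensions of a finite field are power sums of `deg f - 1` numbers. -/
theorem exists_sum_addChar_trace_eq {K : Type*} [Field K] [Finite K] {ψ : AddChar K ℂ}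
    (hψ : ψ ≠ 1) {f : Polynomial K} (he : (f.natDegree : K) ≠ 0) :
    ∃ ω : Multiset ℂ, ω.card = f.natDegree - 1 ∧
      ∀ (L : Type) [Field L] [Fintype L] [Algebra K L],
        ∑ x : L, ψ (Algebra.trace K L (Polynomial.aeval x f)) =
          -powerSum ω (Module.finrank K L) := by
  have he0 : 0 < f.natDegree := Nat.pos_of_ne_zero fun h => he (by simp [h])
  obtain ⟨π, hπ'⟩ := LinearMap.exists_leftInverse_of_injective
    (Algebra.linearMap K (AlgebraicClosure K))
    (LinearMap.ker_eq_bot.2 (algebraMap K (AlgebraicClosure K)).injective)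
  have hπ : ∀ a, π (algebraMap K (AlgebraicClosure K) a) = a := fun a =>
    LinearMap.congr_fun hπ' a
  set χ := polyChar ψ π f with hχ
  set N := f.natDegree - 1 with hN
  have hc0 : monicSum χ 0 = 1 := by
    have : monicDeg K 0 = {1} := by
      ext g
      rw [mem_monicDeg, mem_singleton]
      constructor
      · rintro ⟨h1, h2⟩; exact h1.natDegree_eq_zero.1 h2
      · rintro rfl; simp
    rw [monicSum, this, sum_singleton, hχ, polyChar_one]
  have hcz : ∀ m, N < m → monicSum χ m = 0 := fun m hm =>
    monicSum_polyChar_eq_zero hψ hπ he (by omega)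
  set Q : Polynomial ℂ := ∑ m ∈ range (N + 1),
    Polynomial.monomial (N - m) (monicSum χ m) with hQ
  have hQc : ∀ m ≤ N, Q.coeff (N - m) = monicSum χ m := by
    intro m hm
    rw [hQ, Polynomial.finsetSum_coeff, sum_eq_single m]
    · simp
    · intro b hb hbm
      rw [mem_range] at hb
      rw [Polynomial.coeff_monomial, if_neg (by omega)]
    · intro h; simp at h; omega
  have hQd : Q.natDegree ≤ N := by
    refine Polynomial.natDegree_sum_le_of_forall_le _ _ fun m _ => ?_
    exact (Polynomial.natDegree_monomial_le _).trans (Nat.sub_le _ _)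
  have hQN : Q.coeff N = 1 := by simpa [hc0] using hQc 0 (Nat.zero_le _)
  have hQm : Q.Monic := Polynomial.monic_of_natDegree_le_of_coeff_eq_one N hQd hQN
  have hQdeg : Q.natDegree = N :=
    le_antisymm hQd (Polynomial.le_natDegree_of_ne_zero (by rw [hQN]; exact one_ne_zero))
  have hcard : Q.roots.card = N := by
    rw [← (IsAlgClosed.splits Q).natDegree_eq_card_roots, hQdeg]
  refine ⟨Q.roots, hcard, fun L _ _ _ => ?_⟩
  rw [sum_addChar_trace_aeval ψ hπ f]
  refine eq_neg_powerSum Q.roots (monicSum χ) (primeSum χ) (fun j => ?_)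
    (fun m => mul_monicSum_eq (polyChar_one ψ π f) (polyChar_mul ψ π f) m) _ Module.finrank_pos
  by_cases hj : j ≤ N
  · have h := Polynomial.coeff_eq_esymm_roots_of_card (p := Q) (by rw [hcard, hQdeg])
      (k := N - j) (by omega)
    rw [hQdeg, hQm.leadingCoeff, one_mul, Nat.sub_sub_self hj, hQc j hj] at h
    exact h
  · push Not at hj
    rw [hcz j hj, Multiset.esymm, Multiset.powersetCard_eq_empty _ (by omega)]
    simp

theorem exists_relation_of_natDegree_lt {L ι : Type*} [Field L] [Fintype ι]
    (v : ι → Polynomial L) {M : ℕ} (hv : ∀ i, (v i).natDegree < M) (hM : M < Fintype.card ι) :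
    ∃ g : ι → L, ∑ i, g i • v i = 0 ∧ ∃ i, g i ≠ 0 := by
  let v' : ι → Polynomial.degreeLT L M := fun i =>
    ⟨v i, Polynomial.mem_degreeLT.2
      (Polynomial.degree_le_natDegree.trans_lt (by exact_mod_cast hv i))⟩
  have hfd : Module.Finite L (Polynomial.degreeLT L M) :=
    Module.Finite.equiv (Polynomial.degreeLTEquiv L M).symm
  have hrank : Module.finrank L (Polynomial.degreeLT L M) = M := by
    rw [(Polynomial.degreeLTEquiv L M).finrank_eq]; simp
  have hnot : ¬ LinearIndependent L v' := fun h => by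
    have := h.fintype_card_le_finrank
    omega
  obtain ⟨g, hg, hi⟩ := Fintype.not_linearIndependent_iff.1 hnot
  refine ⟨g, ?_, hi⟩
  have := congrArg (Submodule.subtype _) hg
  simpa [v'] using this

theorem sum_ne_zero_of_degree_ne {L ι : Type*} [Field L] [Fintype ι] (u : ι → Polynomial L)
    (hu : ∀ i j, u i ≠ 0 → u j ≠ 0 → (u i).natDegree = (u j).natDegree → i = j)
    (h : ∃ i, u i ≠ 0) : ∑ i, u i ≠ 0 := by
  obtain ⟨i, hi⟩ := h
  intro h0
  have := Polynomial.degree_sum_eq_of_disjoint u univ (by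
    intro a ha b hb hab he
    exact hab (hu a b ha.2 hb.2 (Polynomial.natDegree_eq_of_degree_eq he)))
  rw [h0, Polynomial.degree_zero] at this
  have h2 := (Finset.sup_eq_bot_iff (fun i => (u i).degree) univ).1 this.symm i (mem_univ i)
  exact hi (Polynomial.degree_eq_bot.1 h2)

theorem natDegree_sum_pow_char_pow {L : Type*} [Field L] {p : ℕ} (hp : 1 < p) {F : Polynomial L}
    (hF : 0 < F.natDegree) (ν : ℕ) :
    (∑ i ∈ range (ν + 1), F ^ p ^ i).natDegree = F.natDegree * p ^ ν := by
  induction ν with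
  | zero => simp
  | succ ν ih =>
    rw [sum_range_succ, Polynomial.natDegree_add_eq_right_of_natDegree_lt,
      Polynomial.natDegree_pow, mul_comm]
    rw [ih, Polynomial.natDegree_pow, mul_comm]
    exact Nat.mul_lt_mul_of_pos_right (Nat.pow_lt_pow_right hp (Nat.lt_succ_self _)) hF

theorem stepanov_unknowns_gt {p e B : ℕ} (he0 : 0 < e) (he : e < p) (hB0 : 0 < B) :
    (B - 1) * (p * B) + (B + e + 1) + (p - 1) * (e * B) < B * ((B + e + 1) * p) := by
  obtain ⟨B', rfl⟩ : ∃ B', B = B' + 1 := ⟨B - 1, by omega⟩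
  obtain ⟨p', rfl⟩ : ∃ p', p = p' + 1 := ⟨p - 1, by omega⟩
  have hep : e ≤ p' := by omega
  have hp1 : 1 ≤ p' := by omega
  simp only [Nat.add_sub_cancel]
  have : e ≤ p' * (B' + 1) := by nlinarith
  have h5 : B' ≤ p' * B' := Nat.le_mul_of_pos_left _ hp1
  nlinarith

theorem stepanov_exponents_injective {p e B : ℕ} (hp : p.Prime) (he0 : 0 < e) (he : e < p)
    {a i j a' i' j' : ℕ} (ha : a < B) (ha' : a' < B) (hj : j < p) (hj' : j' < p)
    (h : a + i * (p * B) + j * (e * B) = a' + i' * (p * B) + j' * (e * B)) :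
    a = a' ∧ i = i' ∧ j = j' := by
  have haa : a = a' := by
    have := congrArg (· % B) h
    simpa only [← mul_assoc, Nat.add_mul_mod_self_right, Nat.mod_eq_of_lt ha,
      Nat.mod_eq_of_lt ha'] using this
  have h3 : i * p + j * e = i' * p + j' * e := by
    refine Nat.eq_of_mul_eq_mul_right (by omega : 0 < B) ?_
    rw [haa] at h
    nlinarith
  have hjj : j = j' := by
    have h4 : j * e ≡ j' * e [MOD p] := by
      have := congrArg (· % p) h3
      simpa [Nat.ModEq] using this
    have h5 := Nat.ModEq.cancel_right_of_coprime (Nat.coprime_of_lt_prime he0.ne' he hp) h4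
    rwa [Nat.ModEq, Nat.mod_eq_of_lt hj, Nat.mod_eq_of_lt hj'] at h5
  refine ⟨haa, ?_, hjj⟩
  rw [hjj] at h3
  exact Nat.eq_of_mul_eq_mul_right hp.pos (by omega)

/-- A Stepanov type bound for the number of solutions of a trace equation. -/
theorem card_sum_pow_eq_le {L : Type*} [Field L] [Fintype L] [DecidableEq L] {p : ℕ}
    (hp : p.Prime) [CharP L p] {μ : ℕ} (hμ : 0 < μ) (hq : Fintype.card L = p ^ (2 * μ))
    {F : Polynomial L} (he0 : 0 < F.natDegree) (he : F.natDegree < p) (c : L) :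
    #{x : L | ∑ i ∈ range (2 * μ), (F.eval x) ^ p ^ i = c} ≤
      p ^ (2 * μ - 1) + (2 * F.natDegree + 1) * p ^ μ := by
  have : Fact p.Prime := ⟨hp⟩
  set e := F.natDegree with hedef
  obtain ⟨ν, rfl⟩ : ∃ ν, μ = ν + 1 := ⟨μ - 1, by omega⟩
  set B := p ^ ν with hB
  have hB0 : 0 < B := pow_pos hp.pos _
  have hPB : p ^ (ν + 1) = p * B := by rw [pow_succ, mul_comm]
  set T : Polynomial L := ∑ i ∈ range (ν + 1), F ^ p ^ i with hT
  have hTd : T.natDegree = e * B := natDegree_sum_pow_char_pow hp.one_lt he0 ν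
  have hcTd : (Polynomial.C c - T).natDegree ≤ e * B :=
    (Polynomial.natDegree_sub_le _ _).trans (by simp [hTd])
  set I := B + e + 1 with hI
  let ι := Fin B × Fin I × Fin p
  let v : ι → Polynomial L := fun k =>
    Polynomial.X ^ (k.1.1 * (p * B) + k.2.1.1) * (Polynomial.C c - T) ^ k.2.2.1
  set M := (B - 1) * (p * B) + I + (p - 1) * (e * B) with hM
  have hv : ∀ k, (v k).natDegree < M := by
    rintro ⟨a, i, j⟩
    have h1 : (v (a, i, j)).natDegree ≤ (a.1 * (p * B) + i.1) + j.1 * (e * B) := by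
      refine Polynomial.natDegree_mul_le.trans (add_le_add (by simp) ?_)
      exact Polynomial.natDegree_pow_le.trans (Nat.mul_le_mul_left _ hcTd)
    have h2 : a.1 * (p * B) ≤ (B - 1) * (p * B) := Nat.mul_le_mul_right _ (by omega)
    have h3 : j.1 * (e * B) ≤ (p - 1) * (e * B) := Nat.mul_le_mul_right _ (by omega)
    have := i.2
    omega
  have hMlt : M < Fintype.card ι := by
    simp only [ι, Fintype.card_prod, Fintype.card_fin]
    exact stepanov_unknowns_gt he0 he hB0
  obtain ⟨g, hg, hgne⟩ := exists_relation_of_natDegree_lt v hv hMlt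
  let φ := iterateFrobeniusEquiv L p (ν + 1)
  let s : ι → L := fun k => φ.symm (g k)
  have hs : ∀ k, s k ^ (p ^ (ν + 1)) = g k := by
    intro k
    have h1 := φ.apply_symm_apply (g k)
    rwa [iterateFrobeniusEquiv_def] at h1
  let u : ι → Polynomial L := fun k =>
    Polynomial.C (s k) * (Polynomial.X ^ (k.1.1 + k.2.1.1 * (p * B)) * T ^ k.2.2.1)
  have hT0 : T ≠ 0 := by
    intro h; rw [h, Polynomial.natDegree_zero] at hTd
    have : 0 < e * B := by positivity
    omega
  have hudeg : ∀ k, s k ≠ 0 → (u k).natDegree =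
      k.1.1 + k.2.1.1 * (p * B) + k.2.2.1 * (e * B) := by
    intro k hk
    rw [Polynomial.natDegree_C_mul hk, Polynomial.natDegree_mul
      (pow_ne_zero _ Polynomial.X_ne_zero) (pow_ne_zero _ hT0), Polynomial.natDegree_X_pow,
      Polynomial.natDegree_pow, hTd]
  have hus : ∀ k, u k ≠ 0 → s k ≠ 0 := by
    intro k hk h; exact hk (by simp [u, h])
  set w := ∑ k, u k with hw
  have hw0 : w ≠ 0 := by
    refine sum_ne_zero_of_degree_ne u ?_ ?_
    · rintro ⟨a, i, j⟩ ⟨a', i', j'⟩ h1 h2 h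
      rw [hudeg _ (hus _ h1), hudeg _ (hus _ h2)] at h
      simp only at h
      obtain ⟨ha, hi, hj⟩ := stepanov_exponents_injective hp he0 he a.2 a'.2 j.2 j'.2 h
      exact Prod.ext (Fin.ext ha) (Prod.ext (Fin.ext hi) (Fin.ext hj))
    · obtain ⟨k, hk⟩ := hgne
      have hk' : s k ≠ 0 := by
        intro h; apply hk; rw [← hs k, h, zero_pow (pow_pos hp.pos _).ne']
      exact ⟨k, mul_ne_zero (Polynomial.C_ne_zero.2 hk')
        (mul_ne_zero (pow_ne_zero _ Polynomial.X_ne_zero) (pow_ne_zero _ hT0))⟩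
  have hroot : ∀ x : L, ∑ i ∈ range (2 * (ν + 1)), (F.eval x) ^ p ^ i = c → w.eval x = 0 := by
    intro x hx
    have hTx : (T.eval x) ^ p ^ (ν + 1) = c - T.eval x := by
      rw [eq_sub_iff_add_eq, ← hx, two_mul, sum_range_add, hT, Polynomial.eval_finsetSum,
        sum_pow_char_pow, add_comm]
      congr 1
      · simp
      · refine sum_congr rfl fun i _ => ?_
        rw [Polynomial.eval_pow, ← pow_mul, ← pow_add, add_comm]
    have hxq : x ^ (p * B * (p * B)) = x := by
      have := FiniteField.pow_card x
      rwa [hq, two_mul, pow_add, hPB] at this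
    have : (w.eval x) ^ p ^ (ν + 1) = (∑ k, g k • v k).eval x := by
      rw [hw, Polynomial.eval_finsetSum, sum_pow_char_pow, Polynomial.eval_finsetSum]
      refine sum_congr rfl fun k _ => ?_
      simp only [u, v, Polynomial.eval_mul, Polynomial.eval_C, Polynomial.eval_pow,
        Polynomial.eval_X, Polynomial.eval_smul, Polynomial.eval_sub, smul_eq_mul, mul_pow, hs]
      congr 2
      · rw [hPB, ← pow_mul, add_mul, pow_add, pow_add, mul_assoc, mul_comm k.2.1.1,
          pow_mul x _ k.2.1.1, hxq]
      · rw [← pow_mul, mul_comm k.2.2.1, pow_mul, hTx]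
    rw [hg, Polynomial.eval_zero] at this
    exact pow_eq_zero_iff (pow_pos hp.pos _).ne' |>.1 this
  have hwd : w.natDegree ≤ (B - 1) + (I - 1) * (p * B) + (p - 1) * (e * B) := by
    refine Polynomial.natDegree_sum_le_of_forall_le _ _ fun k _ => ?_
    by_cases hk : s k = 0
    · simp [u, hk]
    · rw [hudeg k hk]
      have h1 := k.1.2
      have h2 : k.2.1.1 * (p * B) ≤ (I - 1) * (p * B) := Nat.mul_le_mul_right _ (by omega)
      have h3 : k.2.2.1 * (e * B) ≤ (p - 1) * (e * B) := Nat.mul_le_mul_right _ (by omega)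
      omega
  have hcount : #{x : L | ∑ i ∈ range (2 * (ν + 1)), (F.eval x) ^ p ^ i = c} ≤ w.natDegree := by
    refine Polynomial.card_le_degree_of_subset_roots fun x hx => ?_
    rw [Polynomial.mem_roots hw0]
    exact hroot x (mem_filter.1 hx).2
  refine hcount.trans (hwd.trans ?_)
  have h2 : p ^ (2 * (ν + 1) - 1) = p * B * B := by
    rw [hB, show 2 * (ν + 1) - 1 = ν + ν + 1 by omega, pow_succ, pow_add]; ring
  have h3 : (p - 1) * (e * B) ≤ p * (e * B) := Nat.mul_le_mul_right _ (by omega)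
  have h4 : B ≤ p * B := Nat.le_mul_of_pos_left _ hp.pos
  rw [h2, hPB, hI, Nat.add_sub_cancel]
  nlinarith [Nat.sub_le B 1]

theorem norm_sum_addChar_trace_le {p : ℕ} [Fact p.Prime] {ψ : AddChar (ZMod p) ℂ} (hψ : ψ ≠ 1)
    {L : Type*} [Field L] [Fintype L] [Algebra (ZMod p) L] {μ : ℕ} (hμ : 0 < μ)
    (hL : Module.finrank (ZMod p) L = 2 * μ) {f : Polynomial (ZMod p)} (he0 : 0 < f.natDegree)
    (he : f.natDegree < p) :
    ‖∑ x : L, ψ (Algebra.trace (ZMod p) L (Polynomial.aeval x f))‖ ≤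
      2 * p * (2 * f.natDegree + 1) * p ^ μ := by
  classical
  have hp : p.Prime := Fact.out
  have hchar : CharP L p := charP_of_injective_algebraMap (algebraMap (ZMod p) L).injective p
  have hcard : Fintype.card L = p ^ (2 * μ) := by
    rw [← Nat.card_eq_fintype_card, Module.natCard_eq_pow_finrank (K := ZMod p), hL, Nat.card_zmod]
  set N : ZMod p → ℕ := fun a =>
    #{x : L | Algebra.trace (ZMod p) L (Polynomial.aeval x f) = a} with hN
  set b : ℝ := (2 * f.natDegree + 1) * p ^ μ with hb
  have hb0 : 0 ≤ b := by positivity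
  set y : ZMod p → ℝ := fun a => N a - p ^ (2 * μ - 1) with hy
  have hNle : ∀ a, y a ≤ b := by
    intro a
    have h := card_sum_pow_eq_le hp hμ hcard
      (F := f.map (algebraMap (ZMod p) L)) (by rwa [Polynomial.natDegree_map])
      (by rwa [Polynomial.natDegree_map]) (algebraMap (ZMod p) L a)
    have heq : N a = #{x : L | ∑ i ∈ range (2 * μ),
        ((f.map (algebraMap (ZMod p) L)).eval x) ^ p ^ i = algebraMap (ZMod p) L a} := by
      refine congrArg card (filter_congr fun x _ => ?_)
      rw [← (algebraMap (ZMod p) L).injective.eq_iff, FiniteField.algebraMap_trace_eq_sum_pow, hL,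
        Nat.card_zmod, Polynomial.eval_map_algebraMap]
    rw [← heq, Polynomial.natDegree_map] at h
    have h' : (N a : ℝ) ≤ p ^ (2 * μ - 1) + (2 * f.natDegree + 1) * p ^ μ := by exact_mod_cast h
    simp only [hy, hb]; linarith
  have hNsum : ∑ a, N a = p ^ (2 * μ) := by
    rw [← hcard, ← card_univ]
    exact (card_eq_sum_card_fiberwise fun x _ => mem_coe.2 (mem_univ _)).symm
  have hysum : ∑ a, y a = 0 := by
    simp only [hy, sum_sub_distrib, sum_const, card_univ, ZMod.card, nsmul_eq_mul]
    rw [← Nat.cast_sum, hNsum, Nat.cast_pow, ← pow_succ', Nat.sub_add_cancel (by omega), sub_self]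
  have hS : ∑ x : L, ψ (Algebra.trace (ZMod p) L (Polynomial.aeval x f)) =
      ∑ a, (y a : ℂ) * ψ a := by
    simp only [hy, Complex.ofReal_sub, sub_mul, sum_sub_distrib, ← mul_sum,
      AddChar.sum_eq_zero_of_ne_one hψ, mul_zero, sub_zero]
    rw [← sum_fiberwise_of_maps_to
      (g := fun x => Algebra.trace (ZMod p) L (Polynomial.aeval x f)) (t := univ)
      (fun x _ => mem_univ _)]
    refine sum_congr rfl fun a _ => ?_
    rw [sum_congr rfl fun x hx => by rw [(mem_filter.1 hx).2], sum_const, nsmul_eq_mul]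
    simp [hN]
  rw [hS]
  calc ‖∑ a, (y a : ℂ) * ψ a‖ ≤ ∑ a, ‖(y a : ℂ) * ψ a‖ := norm_sum_le _ _
    _ ≤ ∑ a, (2 * b - y a) := by
        refine sum_le_sum fun a _ => ?_
        rw [norm_mul, AddChar.norm_apply, mul_one, Complex.norm_real, Real.norm_eq_abs, abs_le]
        constructor <;> linarith [hNle a]
    _ = 2 * p * (2 * f.natDegree + 1) * p ^ μ := by
        rw [sum_sub_distrib, hysum, sum_const, card_univ, ZMod.card, nsmul_eq_mul, hb]; ring

/-- Bounded power sums force the summands into the closed unit disc. -/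
theorem norm_le_one_of_norm_powerSum_le {s : Multiset ℂ} {C : ℝ}
    (h : ∀ μ : ℕ, 0 < μ → ‖powerSum s μ‖ ≤ C) {z : ℂ} (hz : z ∈ s) : ‖z‖ ≤ 1 := by
  classical
  set A : Polynomial ℂ := ∏ w ∈ s.toFinset.erase z, (Polynomial.X - Polynomial.C w) with hA
  have hAz : A.eval z ≠ 0 := by
    rw [hA, Polynomial.eval_prod, prod_ne_zero_iff]
    intro w hw
    simpa [sub_eq_zero] using (ne_of_mem_erase hw).symm
  have hAw : ∀ w ∈ s.toFinset, w ≠ z → A.eval w = 0 := by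
    intro w hw hwz
    rw [hA, Polynomial.eval_prod]
    exact prod_eq_zero (mem_erase.2 ⟨hwz, hw⟩) (by simp)
  have hid : ∀ μ, ∑ k ∈ range (A.natDegree + 1), A.coeff k * powerSum s (μ + k) =
      s.count z * A.eval z * z ^ μ := by
    intro μ
    have h1 : ∑ k ∈ range (A.natDegree + 1), A.coeff k * powerSum s (μ + k) =
        (s.map fun w => A.eval w * w ^ μ).sum := by
      simp only [powerSum, ← Multiset.sum_map_mul_left, Polynomial.eval_eq_sum_range, sum_mul]
      rw [Finset.sum, Multiset.sum_map_sum_map]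
      refine congrArg _ (Multiset.map_congr rfl fun w _ => ?_)
      refine Finset.sum_congr rfl fun k _ => ?_
      rw [pow_add]; ring
    rw [h1, Finset.sum_multiset_map_count, sum_eq_single z]
    · rw [nsmul_eq_mul, mul_assoc]
    · intro w hw hwz
      rw [hAw w hw hwz]; simp
    · intro hzs
      exact absurd (Multiset.mem_toFinset.2 hz) hzs
  have hcount : (1 : ℝ) ≤ s.count z := by exact_mod_cast Multiset.one_le_count_iff_mem.2 hz
  by_contra! hlt
  have hbd : ∀ μ : ℕ, ‖A.eval z‖ * ‖z‖ ^ (μ + 1) ≤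
      ∑ k ∈ range (A.natDegree + 1), ‖A.coeff k‖ * C := by
    intro μ
    calc ‖A.eval z‖ * ‖z‖ ^ (μ + 1) ≤ s.count z * (‖A.eval z‖ * ‖z‖ ^ (μ + 1)) :=
          le_mul_of_one_le_left (by positivity) hcount
      _ = ‖∑ k ∈ range (A.natDegree + 1), A.coeff k * powerSum s (μ + 1 + k)‖ := by
          rw [hid, norm_mul, norm_mul, norm_pow, Complex.norm_natCast, mul_assoc]
      _ ≤ _ := (norm_sum_le _ _).trans (sum_le_sum fun k _ => by
          rw [norm_mul]
          exact mul_le_mul_of_nonneg_left (h _ (by omega)) (norm_nonneg _))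
  have hAz' : 0 < ‖A.eval z‖ := norm_pos_iff.2 hAz
  obtain ⟨μ, hμ⟩ := pow_unbounded_of_one_lt
    ((∑ k ∈ range (A.natDegree + 1), ‖A.coeff k‖ * C) / ‖A.eval z‖) hlt
  rw [div_lt_iff₀ hAz'] at hμ
  have := hbd μ
  have h2 : ‖z‖ ^ μ ≤ ‖z‖ ^ (μ + 1) := pow_le_pow_right₀ hlt.le (Nat.le_succ _)
  nlinarith

/-- **Weil's bound** for additive character sums of polynomials over prime fields. -/
theorem norm_sum_addChar_eval_le {p : ℕ} [Fact p.Prime] {ψ : AddChar (ZMod p) ℂ} (hψ : ψ ≠ 1)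
    {f : Polynomial (ZMod p)} (he0 : 0 < f.natDegree) (he : f.natDegree < p) :
    ‖∑ x : ZMod p, ψ (f.eval x)‖ ≤ (f.natDegree - 1 : ℕ) * √p := by
  have hp : p.Prime := Fact.out
  have hpos : (0 : ℝ) < p := by exact_mod_cast hp.pos
  have hne : (f.natDegree : ZMod p) ≠ 0 := by
    rw [Ne, ZMod.natCast_eq_zero_iff]
    exact fun h => absurd (Nat.le_of_dvd he0 h) (by omega)
  obtain ⟨ω, hcard, hω⟩ := exists_sum_addChar_trace_eq hψ hne
  set s : Multiset ℂ := ω.map fun z => z ^ 2 / p with hs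
  have hps : ∀ μ, powerSum s μ * p ^ μ = powerSum ω (2 * μ) := by
    intro μ
    rw [hs, powerSum, powerSum, Multiset.map_map, ← Multiset.sum_map_mul_right]
    refine congrArg _ (Multiset.map_congr rfl fun z _ => ?_)
    simp only [Function.comp]
    rw [div_pow, div_mul_cancel₀, ← pow_mul]
    exact pow_ne_zero _ (by exact_mod_cast hp.ne_zero)
  have hbound : ∀ μ : ℕ, 0 < μ → ‖powerSum s μ‖ ≤ 2 * p * (2 * f.natDegree + 1) := by
    intro μ hμ
    have : Fintype (GaloisField p (2 * μ)) := Fintype.ofFinite _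
    have hfin : Module.finrank (ZMod p) (GaloisField p (2 * μ)) = 2 * μ :=
      GaloisField.finrank p (by omega)
    have h := norm_sum_addChar_trace_le hψ hμ hfin he0 he
    rw [hω, hfin, norm_neg, ← hps, norm_mul, norm_pow, Complex.norm_natCast] at h
    exact le_of_mul_le_mul_right h (by positivity)
  have hz : ∀ z ∈ ω, ‖z‖ ≤ √p := by
    intro z hz
    have := norm_le_one_of_norm_powerSum_le hbound (Multiset.mem_map_of_mem _ hz)
    rw [norm_div, norm_pow, Complex.norm_natCast, div_le_one hpos] at this
    exact Real.le_sqrt_of_sq_le this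
  have h1 := hω (ZMod p)
  simp only [Algebra.trace_self, LinearMap.id_apply, Module.finrank_self,
    Polynomial.coe_aeval_eq_eval] at h1
  rw [h1, norm_neg, ← hcard]
  have := Multiset.le_sum_of_subadditive (fun z : ℂ => ‖z‖) norm_zero.le norm_add_le (ω.map (· ^ 1))
  rw [powerSum]
  refine this.trans ?_
  rw [Multiset.map_map]
  simp only [Function.comp_def, pow_one]
  refine (Multiset.sum_le_card_nsmul _ (√p) ?_).trans (by simp)
  intro x hx
  obtain ⟨z, hz', rfl⟩ := Multiset.mem_map.1 hx
  exact hz z hz'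

theorem sum_comp_castHom {p n : ℕ} [NeZero n] [NeZero p] (hpn : p ∣ n) {M : Type*}
    [AddCommMonoid M] (g : ZMod p → M) :
    ∑ x : ZMod n, g (ZMod.castHom hpn (ZMod p) x) = (n / p) • ∑ y, g y := by
  classical
  have hsurj := ZMod.castHom_surjective hpn
  have hconst : ∀ y : ZMod p, #{x : ZMod n | ZMod.castHom hpn (ZMod p) x = y} =
      #{x : ZMod n | ZMod.castHom hpn (ZMod p) x = 0} := fun y =>
    AddMonoidHom.card_fiber_eq_of_mem_range (ZMod.castHom hpn (ZMod p)).toAddMonoidHom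
      (hsurj y) (hsurj 0)
  have htot : n = p * #{x : ZMod n | ZMod.castHom hpn (ZMod p) x = 0} := by
    have h := card_eq_sum_card_fiberwise (s := (univ : Finset (ZMod n))) (t := univ)
      (f := ZMod.castHom hpn (ZMod p)) fun x _ => mem_coe.2 (mem_univ _)
    rw [sum_congr rfl fun y _ => hconst y, sum_const, card_univ, card_univ, ZMod.card, ZMod.card,
      smul_eq_mul] at h
    exact h
  have hdiv : n / p = #{x : ZMod n | ZMod.castHom hpn (ZMod p) x = 0} := by
    conv_lhs => rw [htot]
    exact Nat.mul_div_cancel_left _ (Nat.pos_of_ne_zero (NeZero.ne p))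
  rw [← sum_fiberwise_of_maps_to (g := ZMod.castHom hpn (ZMod p)) (t := univ)
    (fun x _ => mem_univ _), smul_sum]
  refine sum_congr rfl fun y _ => ?_
  rw [sum_congr rfl fun x hx => by rw [(mem_filter.1 hx).2], sum_const, hconst, hdiv]

/-- An additive character killing the multiples of `p` factors through reduction modulo `p`. -/
theorem exists_addChar_castHom {p n : ℕ} [NeZero n] [NeZero p] (hpn : p ∣ n)
    {Ψ : AddChar (ZMod n) ℂ} (h : ∀ y, Ψ (p * y) = 1) :
    ∃ ψ : AddChar (ZMod p) ℂ, ∀ x, Ψ x = ψ (ZMod.castHom hpn (ZMod p) x) := by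
  have hmod : ∀ k : ℕ, Ψ (k : ZMod n) = Ψ ((k % p : ℕ) : ZMod n) := by
    intro k
    conv_lhs => rw [← Nat.div_add_mod k p]
    rw [Nat.cast_add, Nat.cast_mul, AddChar.map_add_eq_mul, h, one_mul]
  refine ⟨⟨fun u => Ψ (u.val : ZMod n), by simp, fun u v => ?_⟩, fun x => ?_⟩
  · rw [ZMod.val_add, ← hmod, Nat.cast_add, AddChar.map_add_eq_mul]
  · change Ψ x = Ψ _
    rw [ZMod.castHom_apply, ZMod.cast_eq_val, ZMod.val_natCast, ← hmod, ZMod.natCast_zmod_val]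

theorem isUnit_of_castHom_ne_zero {p t : ℕ} (hp : p.Prime) (hpn : p ∣ p ^ t)
    [NeZero (p ^ t)] {x : ZMod (p ^ t)} (hx : ZMod.castHom hpn (ZMod p) x ≠ 0) : IsUnit x := by
  rw [ZMod.castHom_apply, ZMod.cast_eq_val, Ne, ZMod.natCast_eq_zero_iff] at hx
  rw [← ZMod.natCast_zmod_val x, ZMod.isUnit_iff_coprime]
  exact ((hp.coprime_iff_not_dvd.2 hx).symm).pow_right _

theorem derivative_ne_zero_of_natDegree_lt {p : ℕ} [Fact p.Prime] {g : Polynomial (ZMod p)}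
    (h0 : 0 < g.natDegree) (h : g.natDegree < p) : g.derivative ≠ 0 := by
  intro hd
  have hc := congrArg (fun q => q.coeff (g.natDegree - 1)) hd
  simp only [Polynomial.coeff_derivative, Polynomial.coeff_zero] at hc
  rw [Nat.sub_add_cancel h0, ← Nat.cast_add_one, Nat.sub_add_cancel h0, mul_eq_zero,
    ZMod.natCast_eq_zero_iff] at hc
  rcases hc with hc | hc
  · rw [← Polynomial.leadingCoeff, Polynomial.leadingCoeff_eq_zero] at hc
    simp [hc] at h0
  · exact absurd (Nat.le_of_dvd h0 hc) (by omega)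

/-- The bound for a complete character sum whose character has conductor at least `p ^ 2`. -/
theorem norm_sum_addChar_le_card_nonunit {p n : ℕ} [NeZero n] {Ψ : AddChar (ZMod n) ℂ} {m : ℕ}
    (hm : 2 ≤ m) (htriv : ∀ y, Ψ (p ^ m * y) = 1) (hnon : ∃ y, Ψ (p ^ (m - 1) * y) ≠ 1)
    (g : Polynomial (ZMod n)) [DecidablePred fun x : ZMod n => ¬ IsUnit (g.derivative.eval x)] :
    ‖∑ x, Ψ (g.eval x)‖ ≤ #{x : ZMod n | ¬ IsUnit (g.derivative.eval x)} := by
  have hshift : ∀ x z : ZMod n, Ψ (g.eval (x + p ^ (m - 1) * z)) =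
      Ψ (g.eval x) * Ψ (p ^ (m - 1) * g.derivative.eval x * z) := by
    intro x z
    obtain ⟨k, hk⟩ := g.binomExpansion x (p ^ (m - 1) * z)
    have h2 : k * ((p : ZMod n) ^ (m - 1) * z) ^ 2 = p ^ m * (k * z ^ 2 * p ^ (m - 2)) := by
      rw [mul_pow, ← pow_mul, show (m - 1) * 2 = m + (m - 2) by omega, pow_add]; ring
    rw [hk, AddChar.map_add_eq_mul, AddChar.map_add_eq_mul, h2, htriv, mul_one]
    congr 2; ring
  have hinner : ∀ x : ZMod n, IsUnit (g.derivative.eval x) →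
      ∑ z, Ψ (p ^ (m - 1) * g.derivative.eval x * z) = 0 := by
    intro x hx
    have hne : Ψ.mulShift (p ^ (m - 1) * g.derivative.eval x) ≠ 1 := by
      obtain ⟨y, hy⟩ := hnon
      obtain ⟨u, hu⟩ := hx
      refine AddChar.ne_one_iff.2 ⟨↑u⁻¹ * y, ?_⟩
      rw [AddChar.mulShift_apply, ← hu, mul_assoc, Units.mul_inv_cancel_left]
      exact hy
    simpa only [AddChar.mulShift_apply] using AddChar.sum_eq_zero_of_ne_one hne
  have hn : (0 : ℝ) < n := by exact_mod_cast Nat.pos_of_ne_zero (NeZero.ne n)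
  have havg : (n : ℂ) * ∑ x, Ψ (g.eval x) =
      ∑ x, Ψ (g.eval x) * ∑ z, Ψ (p ^ (m - 1) * g.derivative.eval x * z) := by
    calc (n : ℂ) * ∑ x, Ψ (g.eval x)
        = ∑ z : ZMod n, ∑ x, Ψ (g.eval (x + p ^ (m - 1) * z)) := by
          rw [sum_congr rfl fun z _ => Fintype.sum_equiv
            (Equiv.addRight ((p : ZMod n) ^ (m - 1) * z))
            (fun x => Ψ (g.eval (x + p ^ (m - 1) * z))) (fun x => Ψ (g.eval x)) fun x => rfl,
            sum_const, card_univ, ZMod.card, nsmul_eq_mul]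
      _ = _ := by
          rw [sum_comm]
          refine sum_congr rfl fun x _ => ?_
          rw [mul_sum]
          exact sum_congr rfl fun z _ => hshift x z
  have hle : (n : ℝ) * ‖∑ x, Ψ (g.eval x)‖ ≤
      n * #{x : ZMod n | ¬ IsUnit (g.derivative.eval x)} := by
    rw [← Complex.norm_natCast, ← norm_mul, havg, Complex.norm_natCast, mul_comm (n : ℝ),
      ← nsmul_eq_mul, ← sum_const, sum_filter]
    refine (norm_sum_le _ _).trans (sum_le_sum fun x _ => ?_)
    by_cases hx : IsUnit (g.derivative.eval x)
    · rw [hinner x hx]; simp [hx]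
    · rw [if_pos hx, norm_mul, AddChar.norm_apply, one_mul]
      refine (norm_sum_le _ _).trans ?_
      simp [AddChar.norm_apply, ZMod.card]
  exact le_of_mul_le_mul_left hle hn

/-- Complete additive character sums of polynomials modulo prime powers. -/
theorem norm_sum_addChar_eval_primePower_le {p t : ℕ} [Fact p.Prime] (ht : 1 ≤ t)
    [NeZero (p ^ t)] {Ψ : AddChar (ZMod (p ^ t)) ℂ} (hΨ : Ψ ≠ 1) (f : Polynomial ℤ)
    (he0 : 0 < (f.map (Int.castRingHom (ZMod p))).natDegree)
    (he : (f.map (Int.castRingHom (ZMod p))).natDegree < p) :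
    ‖∑ x, Ψ ((f.map (Int.castRingHom (ZMod (p ^ t)))).eval x)‖ ≤
      (p : ℝ) ^ (t - 1) * (((f.map (Int.castRingHom (ZMod p))).natDegree - 1 : ℕ) * √p) := by
  classical
  have hp : p.Prime := Fact.out
  have hpn : p ∣ p ^ t := dvd_pow_self p (by omega)
  have hquot : p ^ t / p = p ^ (t - 1) := by
    simpa using Nat.pow_div ht hp.pos
  set g := f.map (Int.castRingHom (ZMod (p ^ t))) with hg
  set h := f.map (Int.castRingHom (ZMod p)) with hh
  set π := ZMod.castHom hpn (ZMod p) with hπ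
  have hmap : g.map π = h := by
    rw [hg, hh, Polynomial.map_map]
    congr 1
    exact RingHom.ext_int _ _
  have hev : ∀ x, π (g.eval x) = h.eval (π x) := fun x => by
    rw [← hmap, Polynomial.eval_map_apply]
  have hdev : ∀ x, π (g.derivative.eval x) = h.derivative.eval (π x) := fun x => by
    rw [← hmap, Polynomial.derivative_map g π, Polynomial.eval_map_apply]
  have hex : ∃ m, ∀ y, Ψ ((p : ZMod (p ^ t)) ^ m * y) = 1 := by
    refine ⟨t, fun y => ?_⟩
    rw [← Nat.cast_pow, ZMod.natCast_self, zero_mul, AddChar.map_zero_eq_one]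
  set m := Nat.find hex with hm
  have hspec : ∀ y, Ψ ((p : ZMod (p ^ t)) ^ m * y) = 1 := Nat.find_spec hex
  have hm0 : m ≠ 0 := by
    intro h0
    obtain ⟨u, hu⟩ := AddChar.ne_one_iff.1 hΨ
    have := hspec u
    rw [h0, pow_zero, one_mul] at this
    exact hu this
  rcases (by omega : m = 1 ∨ 2 ≤ m) with hm1 | hm2
  · rw [hm1, pow_one] at hspec
    obtain ⟨ψ, hψ⟩ := exists_addChar_castHom hpn hspec
    have hψ1 : ψ ≠ 1 := by
      rintro rfl
      exact hΨ (DFunLike.ext _ _ fun x => by rw [hψ]; simp)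
    rw [sum_congr rfl fun x _ => by rw [hψ, ← hπ, hev],
      sum_comp_castHom hpn fun y => ψ (h.eval y), nsmul_eq_mul, norm_mul, Complex.norm_natCast,
      hquot, Nat.cast_pow]
    exact mul_le_mul_of_nonneg_left (norm_sum_addChar_eval_le hψ1 he0 he) (by positivity)
  · have hnon : ∃ y, Ψ ((p : ZMod (p ^ t)) ^ (m - 1) * y) ≠ 1 := by
      have := Nat.find_min hex (m := m - 1) (by omega)
      push Not at this
      exact this
    refine (norm_sum_addChar_le_card_nonunit hm2 hspec hnon g).trans ?_
    have hd0 := derivative_ne_zero_of_natDegree_lt he0 he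
    have hroots : #{y : ZMod p | h.derivative.eval y = 0} ≤ h.natDegree - 1 := by
      refine (Polynomial.card_le_degree_of_subset_roots fun y hy => ?_).trans
        (Polynomial.natDegree_derivative_le h)
      rw [Polynomial.mem_roots hd0]
      exact (mem_filter.1 hy).2
    have hcard : #{x : ZMod (p ^ t) | ¬ IsUnit (g.derivative.eval x)} ≤
        p ^ (t - 1) * (h.natDegree - 1) := by
      calc #{x : ZMod (p ^ t) | ¬ IsUnit (g.derivative.eval x)}
          ≤ #{x : ZMod (p ^ t) | h.derivative.eval (π x) = 0} := by
            refine card_le_card fun x hx => ?_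
            simp only [mem_filter, mem_univ, true_and] at hx ⊢
            rw [← hdev]
            by_contra hne
            exact hx (isUnit_of_castHom_ne_zero hp hpn hne)
        _ = p ^ (t - 1) * #{y : ZMod p | h.derivative.eval y = 0} := by
            rw [card_filter, card_filter,
              sum_comp_castHom hpn fun y => if h.derivative.eval y = 0 then 1 else 0, hquot,
              smul_eq_mul]
        _ ≤ _ := Nat.mul_le_mul_left _ hroots
    have hsqrt : (1 : ℝ) ≤ √p := Real.one_le_sqrt.2 (by exact_mod_cast hp.one_le)
    calc (#{x : ZMod (p ^ t) | ¬ IsUnit (g.derivative.eval x)} : ℝ)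
        ≤ (p : ℝ) ^ (t - 1) * (h.natDegree - 1 : ℕ) := by exact_mod_cast hcard
      _ ≤ _ := by
        refine mul_le_mul_of_nonneg_left ?_ (by positivity)
        exact le_mul_of_one_le_right (by positivity) hsqrt

theorem natDegree_map_pos_of_gcd {p d : ℕ} (hp : p.Prime) (f : Polynomial ℤ)
    (hgcd : Nat.gcd ((Finset.Icc 1 d).gcd fun i => (f.coeff i).natAbs) p = 1) :
    0 < (f.map (Int.castRingHom (ZMod p))).natDegree := by
  by_contra! h0
  have hdvd : p ∣ (Finset.Icc 1 d).gcd fun i => (f.coeff i).natAbs := by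
    refine Finset.dvd_gcd fun i hi => ?_
    have hc := Polynomial.coeff_eq_zero_of_natDegree_lt (p := f.map (Int.castRingHom (ZMod p)))
      (n := i) (by have := (mem_Icc.1 hi).1; omega)
    rw [Polynomial.coeff_map, eq_intCast, ZMod.intCast_zmod_eq_zero_iff_dvd] at hc
    exact Int.natCast_dvd.1 hc
  have := Nat.dvd_gcd hdvd dvd_rfl
  rw [hgcd] at this
  exact hp.one_lt.ne' (Nat.dvd_one.1 this)

theorem sub_one_le_pow (d : ℕ) : ((d - 1 : ℕ) : ℝ) ≤ 2.1 ^ d := by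
  have h := one_add_mul_le_pow (a := (1.1 : ℝ)) (by norm_num) d
  have h2 : ((d - 1 : ℕ) : ℝ) ≤ d := by exact_mod_cast Nat.sub_le d 1
  norm_num at h ⊢
  have : (0 : ℝ) ≤ d := by positivity
  linarith

theorem norm_sum_addChar_eval_le_rpow {p t : ℕ} [Fact p.Prime] (ht : 1 ≤ t)
    [NeZero (p ^ t)] {Ψ : AddChar (ZMod (p ^ t)) ℂ} (hΨ : Ψ ≠ 1) {f : Polynomial ℤ} {d : ℕ}
    (hdeg : f.natDegree = d) (hd : 1 ≤ d)
    (hgcd : Nat.gcd ((Finset.Icc 1 d).gcd fun i => (f.coeff i).natAbs) p = 1) :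
    ‖∑ x, Ψ ((f.map (Int.castRingHom (ZMod (p ^ t)))).eval x)‖ ≤
      4.41 * (p ^ t : ℕ) * (p : ℝ) ^ (-(1 : ℝ) / d) := by
  have hp : p.Prime := Fact.out
  have hp0 : (0 : ℝ) < p := by exact_mod_cast hp.pos
  have hdR : (0 : ℝ) < d := by exact_mod_cast hd
  set s : ℝ := (p : ℝ) ^ (1 / (2 * d) : ℝ) with hs
  have hs0 : 0 < s := Real.rpow_pos_of_pos hp0 _
  have hsp : s ^ (2 * d) = p := by
    rw [hs, ← Real.rpow_natCast, ← Real.rpow_mul hp0.le]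
    push_cast
    rw [one_div_mul_cancel (by positivity), Real.rpow_one]
  have hsqrt : √(p : ℝ) = s ^ d := by
    rw [Real.sqrt_eq_iff_eq_sq hp0.le (by positivity), ← pow_mul, mul_comm d, hsp]
  have hr : (p : ℝ) ^ (-(1 : ℝ) / d) = (s ^ 2)⁻¹ := by
    rw [hs, ← Real.rpow_natCast, ← Real.rpow_mul hp0.le, ← Real.rpow_neg hp0.le]
    congr 1
    push_cast
    field_simp
  rw [hr]
  rcases le_or_gt s 2.1 with hle | hgt
  · calc ‖∑ x, Ψ ((f.map (Int.castRingHom (ZMod (p ^ t)))).eval x)‖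
        ≤ (p ^ t : ℕ) := (norm_sum_le _ _).trans (by simp [AddChar.norm_apply, ZMod.card])
      _ ≤ (p ^ t : ℕ) * (4.41 * (s ^ 2)⁻¹) := by
        refine le_mul_of_one_le_right (by positivity) ?_
        rw [← div_eq_mul_inv, one_le_div (by positivity)]
        nlinarith
      _ = _ := by ring
  · have he0 := natDegree_map_pos_of_gcd hp f hgcd
    have hed : (f.map (Int.castRingHom (ZMod p))).natDegree ≤ d :=
      hdeg ▸ Polynomial.natDegree_map_le
    have hdp : d < p := by
      have h1 := one_add_mul_le_pow (a := (1 : ℝ)) (by norm_num) (2 * d)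
      have h2 : (1 + 1 : ℝ) ^ (2 * d) ≤ s ^ (2 * d) :=
        pow_le_pow_left₀ (by norm_num) (by norm_num at hgt ⊢; linarith) _
      rw [hsp] at h2
      push_cast at h1
      have : (d : ℝ) < p := by linarith
      exact_mod_cast this
    refine (norm_sum_addChar_eval_primePower_le ht hΨ f he0 (by omega)).trans ?_
    have hkey : ((d - 1 : ℕ) : ℝ) * s ^ 2 ≤ 4.41 * s ^ d := by
      rcases (by omega : d = 1 ∨ 2 ≤ d) with rfl | h2
      · simp only [Nat.sub_self, Nat.cast_zero, zero_mul]; positivity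
      · obtain ⟨e, rfl⟩ := Nat.exists_eq_add_of_le' h2
        have h3 : (2.1 : ℝ) ^ e ≤ s ^ e := pow_le_pow_left₀ (by norm_num) hgt.le _
        have h4 := sub_one_le_pow (e + 2)
        rw [pow_add] at h4
        have h5 : ((e + 2 - 1 : ℕ) : ℝ) ≤ 4.41 * s ^ e := by norm_num at h3 h4 ⊢; linarith
        rw [pow_add, ← mul_assoc]
        exact mul_le_mul_of_nonneg_right h5 (by positivity)
    have hpt : ((p ^ t : ℕ) : ℝ) = p ^ (t - 1) * (s ^ d * s ^ d) := by
      rw [← pow_add, ← two_mul, hsp, ← pow_succ, Nat.sub_add_cancel ht, Nat.cast_pow]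
    rw [hsqrt, hpt, ← div_eq_mul_inv, le_div_iff₀ (by positivity)]
    have hcast : (((f.map (Int.castRingHom (ZMod p))).natDegree - 1 : ℕ) : ℝ) ≤ (d - 1 : ℕ) := by
      exact_mod_cast Nat.sub_le_sub_right hed 1
    calc (p : ℝ) ^ (t - 1) *
          (((f.map (Int.castRingHom (ZMod p))).natDegree - 1 : ℕ) * s ^ d) * s ^ 2
        ≤ (p : ℝ) ^ (t - 1) * ((d - 1 : ℕ) * s ^ d) * s ^ 2 := by gcongr
      _ = (p : ℝ) ^ (t - 1) * s ^ d * ((d - 1 : ℕ) * s ^ 2) := by ring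
      _ ≤ (p : ℝ) ^ (t - 1) * s ^ d * (4.41 * s ^ d) := by gcongr
      _ = _ := by ring

/-- Power sums of character values on a subset of `ZMod (p ^ t)`. -/
theorem norm_powerSum_addChar_le {p t : ℕ} [Fact p.Prime] (ht : 1 ≤ t)
    [NeZero (p ^ t)] {f : Polynomial ℤ} {d : ℕ}
    (hdeg : f.natDegree = d) (hd : 1 ≤ d)
    (hgcd : Nat.gcd ((Finset.Icc 1 d).gcd fun i => (f.coeff i).natAbs) p = 1)
    (D : Finset (ZMod (p ^ t))) {j : ZMod (p ^ t)} (hj : j ≠ 0) (i : ℕ) :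
    ‖powerSum (D.val.map fun x => ZMod.stdAddChar
        (j * (f.map (Int.castRingHom (ZMod (p ^ t)))).eval x)) i‖ ≤
      if p ∣ i then (D.card : ℝ) else
        4.41 * (p ^ t : ℕ) * (p : ℝ) ^ (-(1 : ℝ) / d) + ((p ^ t : ℕ) - D.card) := by
  have hp : p.Prime := Fact.out
  have hps : powerSum (D.val.map fun x => ZMod.stdAddChar
      (j * (f.map (Int.castRingHom (ZMod (p ^ t)))).eval x)) i =
      ∑ x ∈ D, (ZMod.stdAddChar.mulShift ((i : ZMod (p ^ t)) * j))
        ((f.map (Int.castRingHom (ZMod (p ^ t)))).eval x) := by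
    rw [powerSum, Multiset.map_map, Finset.sum]
    refine congrArg _ (Multiset.map_congr rfl fun x _ => ?_)
    rw [Function.comp, AddChar.mulShift_apply, ← AddChar.map_nsmul_eq_pow, nsmul_eq_mul, mul_assoc]
  set Ψ : AddChar (ZMod (p ^ t)) ℂ := ZMod.stdAddChar.mulShift (i * j) with hΨdef
  have htriv : ∀ S : Finset (ZMod (p ^ t)),
      ‖∑ x ∈ S, Ψ ((f.map (Int.castRingHom (ZMod (p ^ t)))).eval x)‖ ≤ S.card := fun S =>
    (norm_sum_le _ _).trans (by simp [AddChar.norm_apply])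
  rw [hps]
  split_ifs with hi
  · exact htriv D
  · have hu : IsUnit (i : ZMod (p ^ t)) := by
      rw [ZMod.isUnit_iff_coprime]
      exact ((hp.coprime_iff_not_dvd.2 hi).symm).pow_right _
    have hΨ : Ψ ≠ 1 := ZMod.isPrimitive_stdAddChar (p ^ t) (by
      rw [Ne, hu.mul_right_eq_zero]; exact hj)
    have hfull := norm_sum_addChar_eval_le_rpow ht hΨ hdeg hd hgcd
    rw [← sum_add_sum_compl D] at hfull
    have hc := htriv Dᶜ
    have hcc : ((Dᶜ).card : ℝ) = (p ^ t : ℕ) - D.card := by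
      rw [card_compl, ZMod.card, Nat.cast_sub]
      simpa [ZMod.card] using card_le_univ D
    rw [hcc] at hc
    have := norm_sub_le (∑ x ∈ D, Ψ ((f.map (Int.castRingHom (ZMod (p ^ t)))).eval x) +
      ∑ x ∈ Dᶜ, Ψ ((f.map (Int.castRingHom (ZMod (p ^ t)))).eval x))
      (∑ x ∈ Dᶜ, Ψ ((f.map (Int.castRingHom (ZMod (p ^ t)))).eval x))
    rw [add_sub_cancel_right] at this
    linarith

/-- **Theorem (polynomial subset sums over `ℤ/p^tℤ`).**
Let `n = p^t` be a prime power, let `f ∈ ℤ[x]` have degree `d ≥ 1` with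
`gcd(a_d, …, a_1, p) = 1`. If `D ⊆ ℤ/nℤ` with `|D| = n - c ≥ 4.41·n·p^{-1/d} + c`,
then for all `b` and `0 ≤ k ≤ |D|`,
`|N_f(D,k,b) - (1/n)·C(n-c,k)| ≤ C((n-c)/p + (1-1/p)(4.41·n·p^{-1/d} + c) + k - 1, k)`. -/
theorem polySubsetSum_asymptotic_primePower
    (p t n : ℕ) (hp : p.Prime) (ht : 1 ≤ t) (hn : n = p ^ t)
    (f : Polynomial ℤ) (d : ℕ) (hdeg : f.natDegree = d) (hd : 1 ≤ d)
    (hgcd : Nat.gcd ((Finset.Icc 1 d).gcd fun i => (f.coeff i).natAbs) p = 1)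
    (D : Finset (ZMod n)) (c : ℕ) (hD : (D.card : ℝ) = (n : ℝ) - c)
    (hbig : (n : ℝ) - c ≥ 4.41 * n * ((p : ℝ) ^ (-(1 : ℝ) / d)) + c)
    (b : ZMod n) (k : ℕ) (hk : k ≤ D.card) :
    |(polySubsetSumCount D (f.map (Int.castRingHom (ZMod n))) k b : ℝ)
        - (1 / (n : ℝ)) * realChoose ((n : ℝ) - c) k|
      ≤ realChoose
          (((n : ℝ) - c) / p
            + (1 - 1 / (p : ℝ)) * (4.41 * n * ((p : ℝ) ^ (-(1 : ℝ) / d)) + c)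
            + k - 1) k := by
  subst hn
  have : Fact p.Prime := ⟨hp⟩
  have : NeZero (p ^ t) := ⟨pow_ne_zero _ hp.ne_zero⟩
  have hp1 : (1 : ℝ) ≤ p := by exact_mod_cast hp.one_le
  set A : ℝ := 4.41 * (p ^ t : ℕ) * (p : ℝ) ^ (-(1 : ℝ) / d) + c with hAdef
  have hA : 1 ≤ A := by
    have h1 : (p : ℝ) ^ (-1 : ℝ) ≤ (p : ℝ) ^ (-(1 : ℝ) / d) := by
      refine Real.rpow_le_rpow_of_exponent_le hp1 ?_
      rw [neg_div, neg_le_neg_iff, div_le_one (by exact_mod_cast hd)]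
      exact_mod_cast hd
    have h2 : (1 : ℝ) ≤ (p ^ t : ℕ) * (p : ℝ) ^ (-1 : ℝ) := by
      rw [Real.rpow_neg_one, ← div_eq_mul_inv, one_le_div (by linarith), Nat.cast_pow]
      exact le_self_pow₀ hp1 (by omega)
    have h3 : ((p ^ t : ℕ) : ℝ) * (p : ℝ) ^ (-1 : ℝ) ≤ (p ^ t : ℕ) * (p : ℝ) ^ (-(1 : ℝ) / d) :=
      mul_le_mul_of_nonneg_left h1 (by positivity)
    have hc : (0 : ℝ) ≤ c := by positivity
    rw [hAdef, mul_assoc]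
    linarith
  have hM : 0 < (D.card : ℝ) / p + (1 - 1 / (p : ℝ)) * A := by
    have hq : 0 ≤ 1 - 1 / (p : ℝ) := sub_nonneg.2 ((div_le_one (by linarith)).2 hp1)
    have hDpos : 0 < (D.card : ℝ) := by linarith
    positivity
  rw [← hD, realChoose_natCast_s3]
  refine abs_polySubsetSumCount_sub_le (p ^ t) D _ k b _ (realChoose_pos _ hM k).le fun j hj => ?_
  refine norm_esymm_le_realChoose _ p hp.pos A D.card hA (by linarith) (fun i _ => ?_) k
  have h := norm_powerSum_addChar_le ht hdeg hd hgcd D hj i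
  rwa [show ((p ^ t : ℕ) : ℝ) - D.card = c by linarith, ← hAdef] at h
end
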